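/- arXiv:2211.15879 — 5 statements merged into one kernel-verified Lean document; each statement's English description precedes it below -/
import Mathlib

section
/- For every integer k ≥ 1, the space P_k³ of vector fields on ℝ³ with components homogeneous harmonic polynomials of degree k is the internal direct sum of its three subspaces W_k^o, W_k^−, W_k^+: every p ∈ P_k³ can be written in exactly one way as p = p^o + p^− + p^+ with p^o ∈ W_k^o, p^− ∈ W_k^−, p^+ ∈ W_k^+. -/
noncomputable section

open scoped BigOperators

/-- Points of `ℝ³`. -/
abbrev V3 : Type := Fin 3 → ℝ

/-- The Euclidean inner product on `ℝ³`. -/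
def dot3 (x y : V3) : ℝ := ∑ i, x i * y i

/-- The Euclidean norm on `ℝ³`. -/
def norm3 (x : V3) : ℝ := Real.sqrt (dot3 x x)

/-- The cross product on `ℝ³` (cyclic formula, `(x × y) i = x (i+1) y (i+2) - x (i+2) y (i+1)`). -/
def cross3 (x y : V3) : V3 := fun i => x (i + 1) * y (i + 2) - x (i + 2) * y (i + 1)

/-- Partial derivative in the `i`-th coordinate direction. -/
def pd (i : Fin 3) (f : V3 → ℝ) (x : V3) : ℝ := fderiv ℝ f x (Pi.single i 1)

/-- Gradient of a scalar field. -/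
def grad3 (f : V3 → ℝ) (x : V3) : V3 := fun i => pd i f x

/-- Divergence of a vector field. -/
def div3 (p : V3 → V3) (x : V3) : ℝ := ∑ i, pd i (fun y => p y i) x

/-- Curl of a vector field. -/
def curl3 (p : V3 → V3) (x : V3) : V3 :=
  fun i => pd (i + 1) (fun y => p y (i + 2)) x - pd (i + 2) (fun y => p y (i + 1)) x

/-- `f` is the function of a homogeneous polynomial of degree `k` on `ℝ³`. -/
def IsHomogPoly (k : ℕ) (f : V3 → ℝ) : Prop :=
  ∃ q : MvPolynomial (Fin 3) ℝ, q.IsHomogeneous k ∧ ∀ x, f x = MvPolynomial.eval x q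

/-- `f` is harmonic (its Laplacian vanishes) on all of `ℝ³`. -/
def IsHarmonic (f : V3 → ℝ) : Prop := ∀ x, ∑ i, pd i (pd i f) x = 0

/-- `P_k`: homogeneous harmonic polynomials of degree `k` (as functions on `ℝ³`). -/
def Pk (k : ℕ) : Set (V3 → ℝ) := {f | IsHomogPoly k f ∧ IsHarmonic f}

/-- `P_k³`: vector fields all of whose components lie in `P_k`. -/
def Pk3 (k : ℕ) : Set (V3 → V3) := {p | ∀ i, (fun x => p x i) ∈ Pk k}

/-- Kelvin transform of a degree-`k` homogeneous field: `p*(x) = |x|^{-(2k+1)} p(x)`. -/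
def kelvin (k : ℕ) (p : V3 → V3) : V3 → V3 := fun x => (norm3 x ^ (2 * k + 1))⁻¹ • p x

/-- `W_k^o`: fields in `P_k³` that are divergence free on `ℝ³` and whose Kelvin transform
is divergence free on `ℝ³ \ {0}`. -/
def Wko (k : ℕ) : Set (V3 → V3) :=
  {p | p ∈ Pk3 k ∧ (∀ x, div3 p x = 0) ∧ ∀ x : V3, x ≠ 0 → div3 (kelvin k p) x = 0}

/-- `W_k^-`: fields in `P_k³` that are divergence free and curl free on `ℝ³`. -/
def Wkm (k : ℕ) : Set (V3 → V3) :=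
  {p | p ∈ Pk3 k ∧ (∀ x, div3 p x = 0) ∧ ∀ x, curl3 p x = 0}

/-- `W_k^+`: fields in `P_k³` whose Kelvin transform is divergence free and curl free
on `ℝ³ \ {0}`. -/
def Wkp (k : ℕ) : Set (V3 → V3) :=
  {p | p ∈ Pk3 k ∧ (∀ x : V3, x ≠ 0 → div3 (kelvin k p) x = 0) ∧
    ∀ x : V3, x ≠ 0 → curl3 (kelvin k p) x = 0}

section PolynomialIdentities

open MvPolynomial

theorem MvPolynomial.pderiv_pderiv_comm {σ R : Type*} [CommRing R] (i j : σ)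
    (f : MvPolynomial σ R) : pderiv i (pderiv j f) = pderiv j (pderiv i f) := by
  classical
  have h : ⁅pderiv (R := R) i, pderiv (R := R) j⁆ = 0 := by
    refine derivation_ext fun l => ?_
    rw [Derivation.commutator_apply, pderiv_X, pderiv_X, Pi.single_apply, Pi.single_apply]
    split_ifs <;> simp
  have := congrArg (fun D => D f) h
  simpa [Derivation.commutator_apply, sub_eq_zero] using this

/-- The polynomial `x₀² + x₁² + x₂²`. -/
def normSqPoly : MvPolynomial (Fin 3) ℝ := ∑ i, X i * X i

/-- The Laplacian on polynomials. -/
def lapPoly (f : MvPolynomial (Fin 3) ℝ) : MvPolynomial (Fin 3) ℝ := ∑ i, pderiv i (pderiv i f)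

/-- The divergence of a polynomial vector field. -/
def divPoly (P : Fin 3 → MvPolynomial (Fin 3) ℝ) : MvPolynomial (Fin 3) ℝ :=
  ∑ i, pderiv i (P i)

/-- The curl of a polynomial vector field. -/
def curlPoly (P : Fin 3 → MvPolynomial (Fin 3) ℝ) (i : Fin 3) : MvPolynomial (Fin 3) ℝ :=
  pderiv (i + 1) (P (i + 2)) - pderiv (i + 2) (P (i + 1))

/-- The radial component `x · P` of a polynomial vector field. -/
def radPoly (P : Fin 3 → MvPolynomial (Fin 3) ℝ) : MvPolynomial (Fin 3) ℝ := ∑ i, X i * P i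

/-- The cross product `x × P` for a polynomial vector field. -/
def crossPoly (P : Fin 3 → MvPolynomial (Fin 3) ℝ) (i : Fin 3) : MvPolynomial (Fin 3) ℝ :=
  X (i + 1) * P (i + 2) - X (i + 2) * P (i + 1)

theorem pderiv_X_eq_ite (i j : Fin 3) :
    pderiv i (X j : MvPolynomial (Fin 3) ℝ) = if j = i then 1 else 0 := by
  rw [pderiv_X, Pi.single_apply]

theorem pderiv_two (i : Fin 3) : pderiv i (2 : MvPolynomial (Fin 3) ℝ) = 0 :=
  mod_cast (pderiv i).map_natCast 2

theorem pderiv_normSqPoly (i : Fin 3) : pderiv i normSqPoly = 2 * X i := by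
  fin_cases i <;>
    simp [normSqPoly, Fin.sum_univ_three] <;> ring

theorem isHomogeneous_normSqPoly : normSqPoly.IsHomogeneous 2 :=
  IsHomogeneous.sum _ _ _ fun i _ => (isHomogeneous_X ℝ i).mul (isHomogeneous_X ℝ i)

theorem normSqPoly_ne_zero : normSqPoly ≠ 0 := by
  intro h
  have := congrArg (eval fun _ => (1 : ℝ)) h
  norm_num [normSqPoly] at this

theorem lapPoly_add (f g : MvPolynomial (Fin 3) ℝ) : lapPoly (f + g) = lapPoly f + lapPoly g := by
  simp [lapPoly, Finset.sum_add_distrib]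

theorem lapPoly_sub (f g : MvPolynomial (Fin 3) ℝ) : lapPoly (f - g) = lapPoly f - lapPoly g := by
  simp [lapPoly, Finset.sum_sub_distrib]

theorem lapPoly_C_mul (a : ℝ) (f : MvPolynomial (Fin 3) ℝ) :
    lapPoly (C a * f) = C a * lapPoly f := by
  simp [lapPoly, Finset.mul_sum]

theorem lapPoly_pderiv (i : Fin 3) (f : MvPolynomial (Fin 3) ℝ) :
    lapPoly (pderiv i f) = pderiv i (lapPoly f) := by
  simp only [lapPoly, map_sum]
  exact Finset.sum_congr rfl fun j _ => by
    rw [pderiv_pderiv_comm j i f, pderiv_pderiv_comm j i]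

theorem lapPoly_X_mul (i : Fin 3) (f : MvPolynomial (Fin 3) ℝ) :
    lapPoly (X i * f) = X i * lapPoly f + 2 * pderiv i f := by
  fin_cases i <;>
    simp [lapPoly, Fin.sum_univ_three] <;> ring

theorem lapPoly_radPoly (P : Fin 3 → MvPolynomial (Fin 3) ℝ) (hP : ∀ i, lapPoly (P i) = 0) :
    lapPoly (radPoly P) = 2 * divPoly P := by
  simp only [radPoly, divPoly, Fin.sum_univ_three, lapPoly_add, lapPoly_X_mul, hP]
  ring

theorem lapPoly_normSqPoly_mul (f : MvPolynomial (Fin 3) ℝ) :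
    lapPoly (normSqPoly * f) =
      normSqPoly * lapPoly f + 6 * f + 4 * ∑ i, X i * pderiv i f := by
  simp only [lapPoly, Fin.sum_univ_three, pderiv_mul, map_add, pderiv_normSqPoly,
    pderiv_X_self, pderiv_two]
  ring

theorem MvPolynomial.IsHomogeneous.euler {n : ℕ} {f : MvPolynomial (Fin 3) ℝ}
    (h : f.IsHomogeneous n) : ∑ i, X i * pderiv i f = n * f := by
  simpa using h.sum_X_mul_pderiv

theorem MvPolynomial.IsHomogeneous.euler_pderiv {n : ℕ} {f : MvPolynomial (Fin 3) ℝ}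
    (h : f.IsHomogeneous n) (j : Fin 3) :
    ∑ i, X i * pderiv i (pderiv j f) = (n - 1) * pderiv j f := by
  have key := congrArg (pderiv j) h.euler
  rw [← map_natCast (C : ℝ →+* MvPolynomial (Fin 3) ℝ), pderiv_C_mul, map_natCast] at key
  simp only [map_sum, pderiv_mul, pderiv_X_eq_ite, Finset.sum_add_distrib, ite_mul, one_mul,
    zero_mul, Finset.sum_ite_eq', Finset.mem_univ, if_true] at key
  simp only [fun i => pderiv_pderiv_comm i j f]
  linear_combination key

theorem isHomogeneous_normSqPoly_mul_pderiv {n : ℕ} {f : MvPolynomial (Fin 3) ℝ}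
    (h : f.IsHomogeneous n) (i : Fin 3) : (normSqPoly * pderiv i f).IsHomogeneous (n + 1) := by
  obtain _ | n := n
  · rw [← totalDegree_zero_iff_isHomogeneous, totalDegree_eq_zero_iff_eq_C] at h
    rw [h, pderiv_C, mul_zero]
    exact isHomogeneous_zero _ _ _
  · convert isHomogeneous_normSqPoly.mul h.pderiv using 1
    omega

/-- The polynomial field `|x|² ∇d - (2n + 1) d x`, a multiple of the Kelvin transform of the
gradient of the Kelvin transform of `d`. -/
def kelvinGrad (n : ℕ) (d : MvPolynomial (Fin 3) ℝ) (i : Fin 3) : MvPolynomial (Fin 3) ℝ :=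
  normSqPoly * pderiv i d - C (2 * n + 1 : ℝ) * (X i * d)

variable {n : ℕ} {d : MvPolynomial (Fin 3) ℝ}

theorem isHomogeneous_kelvinGrad (hd : d.IsHomogeneous n) (i : Fin 3) :
    (kelvinGrad n d i).IsHomogeneous (n + 1) := by
  refine (isHomogeneous_normSqPoly_mul_pderiv hd i).sub (IsHomogeneous.C_mul ?_ _)
  simpa [add_comm] using (isHomogeneous_X ℝ i).mul hd

theorem lapPoly_kelvinGrad (hd : d.IsHomogeneous n) (hl : lapPoly d = 0) (i : Fin 3) :
    lapPoly (kelvinGrad n d i) = 0 := by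
  rw [kelvinGrad, lapPoly_sub, lapPoly_C_mul, lapPoly_X_mul, lapPoly_normSqPoly_mul,
    hd.euler_pderiv, lapPoly_pderiv, hl]
  simp [map_ofNat]
  ring

theorem divPoly_kelvinGrad (hd : d.IsHomogeneous n) (hl : lapPoly d = 0) :
    divPoly (kelvinGrad n d) = -C ((n + 1) * (2 * n + 3) : ℝ) * d := by
  have he := hd.euler
  simp only [lapPoly, Fin.sum_univ_three] at he hl
  simp only [divPoly, kelvinGrad, Fin.sum_univ_three, map_sub, pderiv_mul,
    pderiv_normSqPoly, pderiv_X_self]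
  simp [map_ofNat, pderiv_two]
  linear_combination normSqPoly * hl + (1 - 2 * n) * he

theorem radPoly_kelvinGrad (hd : d.IsHomogeneous n) :
    radPoly (kelvinGrad n d) = -C (n + 1 : ℝ) * (normSqPoly * d) := by
  have he := hd.euler
  simp only [Fin.sum_univ_three] at he
  simp only [radPoly, kelvinGrad, Fin.sum_univ_three]
  simp [map_ofNat]
  have hR : normSqPoly = X 0 * X 0 + X 1 * X 1 + X 2 * X 2 := by
    simp [normSqPoly, Fin.sum_univ_three]
  linear_combination normSqPoly * he + (2 * n + 1) * d * hR

theorem normSqPoly_mul_curlPoly_kelvinGrad (i : Fin 3) :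
    normSqPoly * curlPoly (kelvinGrad n d) i
      = C (2 * n + 3 : ℝ) * crossPoly (kelvinGrad n d) i := by
  have h1 : pderiv (i + 1) (X (i + 2) : MvPolynomial (Fin 3) ℝ) = 0 :=
    pderiv_X_of_ne (by fin_cases i <;> decide)
  have h2 : pderiv (i + 2) (X (i + 1) : MvPolynomial (Fin 3) ℝ) = 0 :=
    pderiv_X_of_ne (by fin_cases i <;> decide)
  simp only [curlPoly, crossPoly, kelvinGrad, map_sub, pderiv_mul,
    pderiv_normSqPoly, h1, h2, pderiv_pderiv_comm (i + 2) (i + 1) d]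
  simp [map_ofNat, pderiv_two]
  ring

theorem pderiv_radPoly {m : ℕ} {P : Fin 3 → MvPolynomial (Fin 3) ℝ}
    (hP : ∀ i, (P i).IsHomogeneous m) (i : Fin 3) :
    pderiv i (radPoly P) = C (m + 1 : ℝ) * P i + crossPoly (curlPoly P) i := by
  have he := (hP i).euler
  fin_cases i <;>
  · simp [radPoly, crossPoly, curlPoly, Fin.sum_univ_three] at he ⊢
    linear_combination he

theorem crossPoly_crossPoly (P : Fin 3 → MvPolynomial (Fin 3) ℝ) (i : Fin 3) :
    crossPoly (crossPoly P) i = X i * radPoly P - normSqPoly * P i := by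
  fin_cases i <;>
  · simp [radPoly, crossPoly, normSqPoly, Fin.sum_univ_three]
    ring

theorem divPoly_pderiv (f : MvPolynomial (Fin 3) ℝ) :
    divPoly (fun i => pderiv i f) = lapPoly f := rfl

/-- All components of the polynomial field are homogeneous of degree `m` and harmonic. -/
def IsHarmonicField (m : ℕ) (P : Fin 3 → MvPolynomial (Fin 3) ℝ) : Prop :=
  ∀ i, (P i).IsHomogeneous m ∧ lapPoly (P i) = 0

theorem IsHarmonicField.sub {m : ℕ} {P Q : Fin 3 → MvPolynomial (Fin 3) ℝ}
    (hP : IsHarmonicField m P) (hQ : IsHarmonicField m Q) : IsHarmonicField m (P - Q) :=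
  fun i => ⟨(hP i).1.sub (hQ i).1, by
    rw [Pi.sub_apply, lapPoly_sub, (hP i).2, (hQ i).2, sub_zero]⟩

theorem IsHarmonicField.C_mul {m : ℕ} {P : Fin 3 → MvPolynomial (Fin 3) ℝ}
    (hP : IsHarmonicField m P) (a : ℝ) : IsHarmonicField m (fun i => C a * P i) :=
  fun i => ⟨(hP i).1.C_mul a, by rw [lapPoly_C_mul, (hP i).2, mul_zero]⟩

theorem divPoly_sub (P Q : Fin 3 → MvPolynomial (Fin 3) ℝ) :
    divPoly (P - Q) = divPoly P - divPoly Q := by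
  simp [divPoly, Finset.sum_sub_distrib]

theorem radPoly_sub (P Q : Fin 3 → MvPolynomial (Fin 3) ℝ) :
    radPoly (P - Q) = radPoly P - radPoly Q := by
  simp [radPoly, mul_sub, Finset.sum_sub_distrib]

theorem curlPoly_sub (P Q : Fin 3 → MvPolynomial (Fin 3) ℝ) (i : Fin 3) :
    curlPoly (P - Q) i = curlPoly P i - curlPoly Q i := by
  simp [curlPoly]
  ring

theorem crossPoly_sub (P Q : Fin 3 → MvPolynomial (Fin 3) ℝ) (i : Fin 3) :
    crossPoly (P - Q) i = crossPoly P i - crossPoly Q i := by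
  simp [crossPoly]
  ring

theorem divPoly_C_mul (a : ℝ) (P : Fin 3 → MvPolynomial (Fin 3) ℝ) :
    divPoly (fun i => C a * P i) = C a * divPoly P := by
  simp [divPoly, Finset.mul_sum]

theorem radPoly_C_mul (a : ℝ) (P : Fin 3 → MvPolynomial (Fin 3) ℝ) :
    radPoly (fun i => C a * P i) = C a * radPoly P := by
  simp [radPoly, Finset.mul_sum, mul_left_comm]

theorem curlPoly_C_mul (a : ℝ) (P : Fin 3 → MvPolynomial (Fin 3) ℝ) (i : Fin 3) :
    curlPoly (fun i => C a * P i) i = C a * curlPoly P i := by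
  simp [curlPoly, mul_sub]

theorem crossPoly_C_mul (a : ℝ) (P : Fin 3 → MvPolynomial (Fin 3) ℝ) (i : Fin 3) :
    crossPoly (fun i => C a * P i) i = C a * crossPoly P i := by
  simp only [crossPoly]
  ring

/-- Polynomial counterpart of `Wko`. -/
def IsWkoPoly (m : ℕ) (P : Fin 3 → MvPolynomial (Fin 3) ℝ) : Prop :=
  IsHarmonicField m P ∧ divPoly P = 0 ∧ normSqPoly * divPoly P = C (2 * m + 1 : ℝ) * radPoly P

/-- Polynomial counterpart of `Wkm`. -/
def IsWkmPoly (m : ℕ) (P : Fin 3 → MvPolynomial (Fin 3) ℝ) : Prop :=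
  IsHarmonicField m P ∧ divPoly P = 0 ∧ ∀ i, curlPoly P i = 0

/-- Polynomial counterpart of `Wkp`. -/
def IsWkpPoly (m : ℕ) (P : Fin 3 → MvPolynomial (Fin 3) ℝ) : Prop :=
  IsHarmonicField m P ∧ normSqPoly * divPoly P = C (2 * m + 1 : ℝ) * radPoly P ∧
    ∀ i, normSqPoly * curlPoly P i = C (2 * m + 1 : ℝ) * crossPoly P i

theorem IsWkoPoly.sub {m : ℕ} {P Q : Fin 3 → MvPolynomial (Fin 3) ℝ}
    (hP : IsWkoPoly m P) (hQ : IsWkoPoly m Q) : IsWkoPoly m (P - Q) := by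
  refine ⟨hP.1.sub hQ.1, by rw [divPoly_sub, hP.2.1, hQ.2.1, sub_zero], ?_⟩
  rw [divPoly_sub, radPoly_sub]
  linear_combination hP.2.2 - hQ.2.2

theorem IsWkmPoly.sub {m : ℕ} {P Q : Fin 3 → MvPolynomial (Fin 3) ℝ}
    (hP : IsWkmPoly m P) (hQ : IsWkmPoly m Q) : IsWkmPoly m (P - Q) :=
  ⟨hP.1.sub hQ.1, by rw [divPoly_sub, hP.2.1, hQ.2.1, sub_zero], fun i => by
    rw [curlPoly_sub, hP.2.2, hQ.2.2, sub_zero]⟩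

theorem IsWkpPoly.sub {m : ℕ} {P Q : Fin 3 → MvPolynomial (Fin 3) ℝ}
    (hP : IsWkpPoly m P) (hQ : IsWkpPoly m Q) : IsWkpPoly m (P - Q) := by
  refine ⟨hP.1.sub hQ.1, ?_, fun i => ?_⟩
  · rw [divPoly_sub, radPoly_sub]
    linear_combination hP.2.1 - hQ.2.1
  · rw [curlPoly_sub, crossPoly_sub]
    linear_combination hP.2.2 i - hQ.2.2 i

theorem IsWkpPoly.C_mul {m : ℕ} {P : Fin 3 → MvPolynomial (Fin 3) ℝ}
    (hP : IsWkpPoly m P) (a : ℝ) : IsWkpPoly m (fun i => C a * P i) := by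
  refine ⟨hP.1.C_mul a, ?_, fun i => ?_⟩
  · rw [divPoly_C_mul, radPoly_C_mul]
    linear_combination C a * hP.2.1
  · rw [curlPoly_C_mul, crossPoly_C_mul]
    linear_combination C a * hP.2.2 i

theorem isWkpPoly_kelvinGrad (hd : d.IsHomogeneous n) (hl : lapPoly d = 0) :
    IsWkpPoly (n + 1) (kelvinGrad n d) := by
  refine ⟨fun i => ⟨isHomogeneous_kelvinGrad hd i, lapPoly_kelvinGrad hd hl i⟩, ?_, fun i => ?_⟩
  · rw [divPoly_kelvinGrad hd hl, radPoly_kelvinGrad hd]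
    simp [map_ofNat]
    ring
  · rw [normSqPoly_mul_curlPoly_kelvinGrad]
    congr 2
    push_cast
    ring

theorem isWkmPoly_pderiv {m : ℕ} {h : MvPolynomial (Fin 3) ℝ} (hh : h.IsHomogeneous (m + 1))
    (hl : lapPoly h = 0) (a : ℝ) : IsWkmPoly m (fun i => C a * pderiv i h) := by
  refine ⟨IsHarmonicField.C_mul (fun i => ⟨hh.pderiv, ?_⟩) a, ?_, fun i => ?_⟩
  · rw [lapPoly_pderiv, hl, map_zero]
  · rw [divPoly_C_mul, divPoly_pderiv, hl, mul_zero]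
  · rw [curlPoly_C_mul, curlPoly, pderiv_pderiv_comm, sub_self, mul_zero]

theorem exists_polynomial_decomposition {P : Fin 3 → MvPolynomial (Fin 3) ℝ}
    (hP : IsHarmonicField (n + 1) P) : ∃ O M Q, IsWkoPoly (n + 1) O ∧ IsWkmPoly (n + 1) M ∧
      IsWkpPoly (n + 1) Q ∧ P = O + M + Q := by
  have hdh : (divPoly P).IsHomogeneous n :=
    IsHomogeneous.sum _ _ _ fun i _ => (hP i).1.pderiv
  have hdl : lapPoly (divPoly P) = 0 := by
    simp only [divPoly, Fin.sum_univ_three, lapPoly_add, lapPoly_pderiv, (hP _).2, map_zero,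
      add_zero]
  set d := divPoly P with hd
  obtain ⟨a, ha⟩ : ∃ a : ℝ, (2 * n + 3) * a = 1 := ⟨_, mul_inv_cancel₀ (by positivity)⟩
  obtain ⟨b, hb⟩ : ∃ b : ℝ, (n + 2) * b = 1 := ⟨_, mul_inv_cancel₀ (by positivity)⟩
  obtain ⟨c, hc⟩ : ∃ c : ℝ, (n + 1) * c = 1 := ⟨_, mul_inv_cancel₀ (by positivity)⟩
  apply_fun (C : ℝ →+* MvPolynomial (Fin 3) ℝ) at ha hb hc
  simp only [map_mul, map_add, map_natCast, map_ofNat, map_one] at ha hb hc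
  set h := radPoly P - C a * (normSqPoly * d) with hh
  have hhh : h.IsHomogeneous (n + 1 + 1) := by
    refine (IsHomogeneous.sum _ _ _ fun i _ => ?_).sub (IsHomogeneous.C_mul ?_ a)
    · rw [add_comm (n + 1)]
      exact (isHomogeneous_X ℝ i).mul (hP i).1
    · rw [add_assoc, add_comm n]
      exact isHomogeneous_normSqPoly.mul hdh
  have hhl : lapPoly h = 0 := by
    rw [hh, lapPoly_sub, lapPoly_C_mul, lapPoly_normSqPoly_mul, hdh.euler, hdl,
      lapPoly_radPoly P fun i => (hP i).2]
    linear_combination -2 * d * ha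
  have hM := isWkmPoly_pderiv hhh hhl b
  have hQ := (isWkpPoly_kelvinGrad hdh hdl).C_mul (-(a * c))
  refine ⟨_, _, _, ⟨(hP.sub hM.1).sub hQ.1, ?_⟩, hM, hQ, by abel⟩
  have hdiv : divPoly (P - (fun i => C b * pderiv i h)
      - fun i => C (-(a * c)) * kelvinGrad n d i) = 0 := by
    rw [divPoly_sub, divPoly_sub, hM.2.1, divPoly_C_mul, divPoly_kelvinGrad hdh hdl, ← hd]
    simp [map_ofNat]
    linear_combination (-d * (n + 1) * C c) * ha - d * hc
  refine ⟨hdiv, ?_⟩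
  rw [hdiv, radPoly_sub, radPoly_sub, radPoly_C_mul, radPoly_C_mul, radPoly_kelvinGrad hdh]
  have he : radPoly (fun i => pderiv i h) = (n + 2) * h := by
    rw [radPoly, hhh.euler]
    push_cast
    ring
  rw [he]
  simp [map_ofNat]
  right
  linear_combination -h * hb - C a * normSqPoly * d * hc - hh

theorem polynomial_decomposition_unique {m : ℕ} (hm : 1 ≤ m)
    {O M Q : Fin 3 → MvPolynomial (Fin 3) ℝ} (hO : IsWkoPoly m O) (hM : IsWkmPoly m M)
    (hQ : IsWkpPoly m Q) (h : O + M + Q = 0) : O = 0 ∧ M = 0 ∧ Q = 0 := by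
  have hc : ∀ t : ℝ, 0 < t → (C t : MvPolynomial (Fin 3) ℝ) ≠ 0 := fun t ht =>
    C_ne_zero.mpr ht.ne'
  have hQeq : Q = 0 - O - M := by
    rw [← h]
    abel
  have hradO : radPoly O = 0 := by
    have := hO.2.2
    rw [hO.2.1, mul_zero, eq_comm] at this
    exact (mul_eq_zero.mp this).resolve_left (hc _ (by positivity))
  have hdivQ : divPoly Q = 0 := by
    rw [hQeq, divPoly_sub, divPoly_sub, hO.2.1, hM.2.1]
    simp [divPoly]
  have hradQ : radPoly Q = 0 := by
    have := hQ.2.1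
    rw [hdivQ, mul_zero, eq_comm] at this
    exact (mul_eq_zero.mp this).resolve_left (hc _ (by positivity))
  have hradM : radPoly M = 0 := by
    have : radPoly M = radPoly 0 - radPoly O - radPoly Q := by
      rw [← radPoly_sub, ← radPoly_sub, ← h]
      congr 1
      abel
    rw [this, hradO, hradQ]
    simp [radPoly]
  have hM0 : M = 0 := by
    funext i
    have := pderiv_radPoly (fun j => (hM.1 j).1) i
    rw [hradM, map_zero, crossPoly, hM.2.2, hM.2.2, mul_zero, mul_zero, sub_zero, add_zero,
      eq_comm] at this
    exact (mul_eq_zero.mp this).resolve_left (hc _ (by positivity))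
  have hQ0 : Q = 0 := by
    funext i
    have h1 := pderiv_radPoly (fun j => (hQ.1 j).1) i
    have h2 := crossPoly_crossPoly Q i
    rw [hradQ, map_zero] at h1
    rw [hradQ] at h2
    have h3 : C (m : ℝ) * (normSqPoly * Q i) = 0 := by
      have e1 := hQ.2.2 (i + 1)
      have e2 := hQ.2.2 (i + 2)
      rw [crossPoly] at h1 h2
      simp only [map_add, map_mul, map_one, map_ofNat, map_natCast] at h1 e1 e2 ⊢
      linear_combination normSqPoly * h1 + X (i + 1) * e2 - X (i + 2) * e1 + (2 * m + 1) * h2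
    have h4 := (mul_eq_zero.mp h3).resolve_left (hc _ (by positivity))
    exact (mul_eq_zero.mp h4).resolve_left normSqPoly_ne_zero
  refine ⟨?_, hM0, hQ0⟩
  simpa [hM0, hQ0] using h

end PolynomialIdentities

section PolynomialFields

open MvPolynomial

/-- The vector field on `ℝ³` defined by a triple of polynomials. -/
def polyField (P : Fin 3 → MvPolynomial (Fin 3) ℝ) : V3 → V3 := fun x i => eval x (P i)

theorem polyField_injective : Function.Injective polyField := fun _ _ h =>
  funext fun i => MvPolynomial.funext fun x => congrFun (congrFun h x) i

theorem polyField_add (P Q : Fin 3 → MvPolynomial (Fin 3) ℝ) :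
    polyField (P + Q) = polyField P + polyField Q := by
  ext x i
  simp [polyField]

theorem hasFDerivAt_eval (q : MvPolynomial (Fin 3) ℝ) (x : V3) :
    HasFDerivAt (fun y : V3 => eval y q)
      (∑ i, eval x (pderiv i q) • ContinuousLinearMap.proj (R := ℝ) (φ := fun _ => ℝ) i) x := by
  induction q using MvPolynomial.induction_on with
  | C a => simpa using hasFDerivAt_const a x
  | add p q hp hq => simpa [add_smul, Finset.sum_add_distrib] using hp.fun_add hq
  | mul_X p j hp =>
    have hj : HasFDerivAt (fun y : V3 => y j)
        (ContinuousLinearMap.proj (R := ℝ) (φ := fun _ => ℝ) j) x :=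
      (ContinuousLinearMap.proj (R := ℝ) (φ := fun _ => ℝ) j).hasFDerivAt
    simp only [map_mul, eval_X]
    refine (hp.fun_mul hj).congr_fderiv ?_
    ext v
    fin_cases j <;> simp [Fin.sum_univ_three] <;> ring

theorem pd_eq_of_hasFDerivAt {f : V3 → ℝ} {f' : V3 →L[ℝ] ℝ} {x : V3} (h : HasFDerivAt f f' x)
    (i : Fin 3) : pd i f x = f' (Pi.single i 1) := by
  rw [pd, h.fderiv]

theorem sum_eval_smul_proj_single (q : Fin 3 → ℝ) (i : Fin 3) :
    (∑ j, q j • ContinuousLinearMap.proj (R := ℝ) (φ := fun _ : Fin 3 => ℝ) j) (Pi.single i 1)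
      = q i := by
  simp [Pi.single_apply]

theorem pd_eval (i : Fin 3) (q : MvPolynomial (Fin 3) ℝ) :
    pd i (fun y => eval y q) = fun x => eval x (pderiv i q) := by
  ext x
  rw [pd_eq_of_hasFDerivAt (hasFDerivAt_eval q x), sum_eval_smul_proj_single]

theorem isHarmonic_eval_iff (q : MvPolynomial (Fin 3) ℝ) :
    IsHarmonic (fun x => eval x q) ↔ lapPoly q = 0 := by
  simp only [IsHarmonic, pd_eval, lapPoly, MvPolynomial.funext_iff, map_sum, map_zero]

theorem mem_Pk_iff {k : ℕ} {f : V3 → ℝ} :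
    f ∈ Pk k ↔ ∃ q : MvPolynomial (Fin 3) ℝ,
      (q.IsHomogeneous k ∧ lapPoly q = 0) ∧ f = fun x => eval x q := by
  constructor
  · rintro ⟨⟨q, hq, hf⟩, hh⟩
    obtain rfl : f = fun x => eval x q := _root_.funext hf
    exact ⟨q, ⟨hq, (isHarmonic_eval_iff q).1 hh⟩, rfl⟩
  · rintro ⟨q, ⟨hq, hl⟩, rfl⟩
    exact ⟨⟨q, hq, fun _ => rfl⟩, (isHarmonic_eval_iff q).2 hl⟩

theorem mem_Pk3_iff {k : ℕ} {p : V3 → V3} :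
    p ∈ Pk3 k ↔ ∃ P, IsHarmonicField k P ∧ p = polyField P := by
  constructor
  · intro hp
    choose P hP he using fun i => mem_Pk_iff.1 (hp i)
    exact ⟨P, hP, by ext x i; exact congrFun (he i) x⟩
  · rintro ⟨P, hP, rfl⟩ i
    exact mem_Pk_iff.2 ⟨P i, hP i, rfl⟩

theorem polyField_mem_Pk3_iff {k : ℕ} {P : Fin 3 → MvPolynomial (Fin 3) ℝ} :
    polyField P ∈ Pk3 k ↔ IsHarmonicField k P := by
  rw [mem_Pk3_iff]
  refine ⟨?_, fun h => ⟨P, h, rfl⟩⟩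
  rintro ⟨Q, hQ, h⟩
  rwa [polyField_injective h]

theorem div3_polyField (P : Fin 3 → MvPolynomial (Fin 3) ℝ) (x : V3) :
    div3 (polyField P) x = eval x (divPoly P) := by
  simp only [div3, polyField, pd_eval, divPoly, map_sum]

theorem curl3_polyField (P : Fin 3 → MvPolynomial (Fin 3) ℝ) (x : V3) (i : Fin 3) :
    curl3 (polyField P) x i = eval x (curlPoly P i) := by
  simp only [curl3, polyField, pd_eval, curlPoly, map_sub]

theorem eval_normSqPoly (x : V3) : eval x normSqPoly = dot3 x x := by
  simp [normSqPoly, dot3]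

theorem dot3_self_pos {x : V3} (hx : x ≠ 0) : 0 < dot3 x x := by
  obtain ⟨i, hi⟩ := Function.ne_iff.1 hx
  exact Finset.sum_pos' (fun j _ => mul_self_nonneg (x j))
    ⟨i, Finset.mem_univ i, mul_self_pos.2 hi⟩

theorem norm3_pos {x : V3} (hx : x ≠ 0) : 0 < norm3 x := Real.sqrt_pos.2 (dot3_self_pos hx)

theorem hasDerivAt_inv_sqrt_pow (m : ℕ) {s : ℝ} (hs : 0 < s) :
    HasDerivAt (fun t : ℝ => (Real.sqrt t ^ m)⁻¹) (-(m / 2) * (Real.sqrt s ^ m)⁻¹ / s) s := by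
  have hr : 0 < Real.sqrt s := Real.sqrt_pos.2 hs
  refine (((Real.hasDerivAt_sqrt hs.ne').fun_pow m).fun_inv (by positivity)).congr_deriv ?_
  have hss : s = Real.sqrt s ^ 2 := (Real.sq_sqrt hs.le).symm
  generalize Real.sqrt s = r at hr hss
  subst hss
  cases m with
  | zero => simp
  | succ m =>
    rw [Nat.add_sub_cancel]
    field_simp
    ring

theorem pd_kelvin_polyField (k : ℕ) (P : Fin 3 → MvPolynomial (Fin 3) ℝ) {x : V3} (hx : x ≠ 0)
    (i j : Fin 3) :
    pd i (fun y => kelvin k (polyField P) y j) x = (norm3 x ^ (2 * k + 1))⁻¹ / dot3 x x *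
      eval x (normSqPoly * pderiv i (P j) - C (2 * k + 1 : ℝ) * (X i * P j)) := by
  have hpos := dot3_self_pos hx
  have hN := (hasFDerivAt_eval normSqPoly x)
  simp only [eval_normSqPoly, pderiv_normSqPoly] at hN
  have h := ((hasDerivAt_inv_sqrt_pow (2 * k + 1) hpos).comp_hasFDerivAt (f := fun y => dot3 y y) x
    hN).mul
    (hasFDerivAt_eval (P j) x)
  have := pd_eq_of_hasFDerivAt h i
  refine this.trans ?_
  simp only [add_apply, smul_apply,
    sum_eval_smul_proj_single, Function.comp]
  simp [eval_normSqPoly, norm3]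
  field_simp
  ring

theorem div3_kelvin_polyField (k : ℕ) (P : Fin 3 → MvPolynomial (Fin 3) ℝ) {x : V3}
    (hx : x ≠ 0) :
    div3 (kelvin k (polyField P)) x = (norm3 x ^ (2 * k + 1))⁻¹ / dot3 x x *
      eval x (normSqPoly * divPoly P - C (2 * k + 1 : ℝ) * radPoly P) := by
  simp only [div3, pd_kelvin_polyField k P hx, ← Finset.mul_sum, ← map_sum]
  rw [Finset.sum_sub_distrib, ← Finset.mul_sum, ← Finset.mul_sum, divPoly, radPoly]

theorem curl3_kelvin_polyField (k : ℕ) (P : Fin 3 → MvPolynomial (Fin 3) ℝ) {x : V3}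
    (hx : x ≠ 0) (i : Fin 3) :
    curl3 (kelvin k (polyField P)) x i = (norm3 x ^ (2 * k + 1))⁻¹ / dot3 x x *
      eval x (normSqPoly * curlPoly P i - C (2 * k + 1 : ℝ) * crossPoly P i) := by
  simp only [curl3, pd_kelvin_polyField k P hx, ← mul_sub, ← map_sub, curlPoly, crossPoly]
  ring_nf

theorem eval_eq_zero_iff_of_ne_zero {k : ℕ} {f : V3 → ℝ} {q : MvPolynomial (Fin 3) ℝ}
    (h0 : eval 0 q = 0)
    (h : ∀ x ≠ 0, f x = (norm3 x ^ (2 * k + 1))⁻¹ / dot3 x x * eval x q) :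
    (∀ x ≠ 0, f x = 0) ↔ q = 0 := by
  constructor
  · refine fun hf => MvPolynomial.funext fun x => ?_
    rw [map_zero]
    rcases eq_or_ne x 0 with rfl | hx
    · exact h0
    · have hc : (norm3 x ^ (2 * k + 1))⁻¹ / dot3 x x ≠ 0 :=
        (div_pos (inv_pos.2 (pow_pos (norm3_pos hx) _)) (dot3_self_pos hx)).ne'
      exact (mul_eq_zero.1 ((h x hx).symm.trans (hf x hx))).resolve_left hc
  · rintro rfl x hx
    rw [h x hx, map_zero, mul_zero]

theorem div3_kelvin_eq_zero_iff {k : ℕ} {P : Fin 3 → MvPolynomial (Fin 3) ℝ} :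
    (∀ x : V3, x ≠ 0 → div3 (kelvin k (polyField P)) x = 0) ↔
      normSqPoly * divPoly P = C (2 * k + 1 : ℝ) * radPoly P := by
  rw [← sub_eq_zero]
  exact eval_eq_zero_iff_of_ne_zero (by simp [normSqPoly, radPoly])
    fun x hx => div3_kelvin_polyField k P hx

theorem curl3_kelvin_eq_zero_iff {k : ℕ} {P : Fin 3 → MvPolynomial (Fin 3) ℝ} :
    (∀ x : V3, x ≠ 0 → curl3 (kelvin k (polyField P)) x = 0) ↔
      ∀ i, normSqPoly * curlPoly P i = C (2 * k + 1 : ℝ) * crossPoly P i := by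
  have key : ∀ i, (∀ x : V3, x ≠ 0 → curl3 (kelvin k (polyField P)) x i = 0) ↔
      normSqPoly * curlPoly P i = C (2 * k + 1 : ℝ) * crossPoly P i := fun i => by
    rw [← sub_eq_zero]
    exact eval_eq_zero_iff_of_ne_zero (by simp [normSqPoly, crossPoly])
      fun x hx => curl3_kelvin_polyField k P hx i
  simp only [← key, _root_.funext_iff, Pi.zero_apply]
  exact ⟨fun h i x hx => h x hx i, fun h x hx i => h i x hx⟩

theorem div3_polyField_eq_zero_iff {P : Fin 3 → MvPolynomial (Fin 3) ℝ} :
    (∀ x, div3 (polyField P) x = 0) ↔ divPoly P = 0 := by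
  simp only [div3_polyField, MvPolynomial.funext_iff, map_zero]

theorem curl3_polyField_eq_zero_iff {P : Fin 3 → MvPolynomial (Fin 3) ℝ} :
    (∀ x, curl3 (polyField P) x = 0) ↔ ∀ i, curlPoly P i = 0 := by
  simp only [_root_.funext_iff, curl3_polyField, MvPolynomial.funext_iff, map_zero, Pi.zero_apply]
  exact forall_comm

theorem polyField_mem_Wko_iff {k : ℕ} {P : Fin 3 → MvPolynomial (Fin 3) ℝ} :
    polyField P ∈ Wko k ↔ IsWkoPoly k P :=
  and_congr polyField_mem_Pk3_iff (and_congr div3_polyField_eq_zero_iff div3_kelvin_eq_zero_iff)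

theorem polyField_mem_Wkm_iff {k : ℕ} {P : Fin 3 → MvPolynomial (Fin 3) ℝ} :
    polyField P ∈ Wkm k ↔ IsWkmPoly k P :=
  and_congr polyField_mem_Pk3_iff
    (and_congr div3_polyField_eq_zero_iff curl3_polyField_eq_zero_iff)

theorem polyField_mem_Wkp_iff {k : ℕ} {P : Fin 3 → MvPolynomial (Fin 3) ℝ} :
    polyField P ∈ Wkp k ↔ IsWkpPoly k P :=
  and_congr polyField_mem_Pk3_iff (and_congr div3_kelvin_eq_zero_iff curl3_kelvin_eq_zero_iff)

end PolynomialFields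

/-- For `k ≥ 1`, `P_k³ = W_k^o ⊕ W_k^- ⊕ W_k^+`: every `p ∈ P_k³` is the
sum of elements of `W_k^o`, `W_k^-`, `W_k^+` in exactly one way. -/
theorem Pk3_direct_sum_decomposition (k : ℕ) (hk : 1 ≤ k) :
    ∀ p ∈ Pk3 k, ∃! t : (V3 → V3) × (V3 → V3) × (V3 → V3),
      t.1 ∈ Wko k ∧ t.2.1 ∈ Wkm k ∧ t.2.2 ∈ Wkp k ∧ p = t.1 + t.2.1 + t.2.2 := by
  intro p hp
  obtain ⟨P, hP, rfl⟩ := mem_Pk3_iff.1 hp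
  obtain ⟨n, rfl⟩ : ∃ n, k = n + 1 := ⟨k - 1, by omega⟩
  obtain ⟨O, M, Q, hO, hM, hQ, hsum⟩ := exists_polynomial_decomposition hP
  refine ⟨(polyField O, polyField M, polyField Q), ⟨polyField_mem_Wko_iff.2 hO,
    polyField_mem_Wkm_iff.2 hM, polyField_mem_Wkp_iff.2 hQ, ?_⟩, ?_⟩
  · rw [hsum, polyField_add, polyField_add]
  · rintro ⟨o, m, q⟩ ⟨ho, hm, hq, hs⟩
    obtain ⟨O', -, rfl⟩ := mem_Pk3_iff.1 ho.1
    obtain ⟨M', -, rfl⟩ := mem_Pk3_iff.1 hm.1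
    obtain ⟨Q', -, rfl⟩ := mem_Pk3_iff.1 hq.1
    rw [polyField_mem_Wko_iff] at ho
    rw [polyField_mem_Wkm_iff] at hm
    rw [polyField_mem_Wkp_iff] at hq
    rw [← polyField_add, ← polyField_add] at hs
    have hs' := polyField_injective hs
    obtain ⟨h1, h2, h3⟩ := polynomial_decomposition_unique hk (ho.sub hO) (hm.sub hM) (hq.sub hQ)
      (by rw [show O' - O + (M' - M) + (Q' - Q) = (O' + M' + Q') - (O + M + Q) by abel, ← hs',
        ← hsum, sub_self])
    rw [sub_eq_zero.1 h1, sub_eq_zero.1 h2, sub_eq_zero.1 h3]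
end
end

section
/- For every integer k ≥ 1, the linear map sending q ∈ P_{k−1} to the vector field p(x) := |x|^{2k+1} ∇( |x|^{−(2k−1)} q(x) ) is a linear isomorphism from P_{k−1} onto W_k^+; in particular, for each q ∈ P_{k−1} this p lies in P_k³ (its components are homogeneous harmonic polynomials of degree k) and its Kelvin transform p*(x) = ∇(|x|^{−(2k−1)} q(x)) is divergence-free and curl-free on ℝ³∖{0}. -/
noncomputable section

open scoped BigOperators

/-- The scalar potential `x ↦ |x|^{-(2k-1)} q(x)` (the Kelvin transform of `q ∈ P_{k-1}`). -/
def kelvinPotential (k : ℕ) (q : V3 → ℝ) : V3 → ℝ := fun y => (norm3 y ^ (2 * k - 1))⁻¹ * q y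

/-- The map `q ↦ (x ↦ |x|^{2k+1} ∇(|x|^{-(2k-1)} q(x)))`. -/
def wkpMap (k : ℕ) (q : V3 → ℝ) : V3 → V3 :=
  fun x => norm3 x ^ (2 * k + 1) • grad3 (kelvinPotential k q) x

namespace KelvinField

open MvPolynomial

theorem pderiv_pderiv_comm {σ R : Type*} [CommRing R] (i j : σ) (f : MvPolynomial σ R) :
    pderiv i (pderiv j f) = pderiv j (pderiv i f) := by
  classical
  have h : ⁅pderiv (R := R) i, pderiv (R := R) j⁆ = 0 := by
    refine MvPolynomial.derivation_ext fun l => ?_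
    simp only [Derivation.commutator_apply, pderiv_X, Pi.single_apply, Derivation.coe_zero,
      Pi.zero_apply]
    split_ifs <;> simp
  have := congrArg (fun D : Derivation R (MvPolynomial σ R) (MvPolynomial σ R) => D f) h
  simpa [Derivation.commutator_apply, sub_eq_zero] using this

/-- The polynomial `|x|²` on `ℝ³`. -/
def normSq : MvPolynomial (Fin 3) ℝ := ∑ i, X i ^ 2

theorem pderiv_normSq (i : Fin 3) : pderiv i normSq = 2 * X i := by
  fin_cases i <;> simp [normSq, Fin.sum_univ_three, Derivation.leibniz_pow, pderiv_X]

theorem normSq_isHomogeneous : normSq.IsHomogeneous 2 :=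
  IsHomogeneous.sum _ _ _ fun i _ => isHomogeneous_X_pow i 2

theorem normSq_ne_zero : normSq ≠ 0 := by
  intro h
  have := congrArg (eval fun _ => (1 : ℝ)) h
  norm_num [normSq, Fin.sum_univ_three] at this

/-- The polynomial Laplacian. -/
def laplacian (Q : MvPolynomial (Fin 3) ℝ) : MvPolynomial (Fin 3) ℝ :=
  ∑ i, pderiv i (pderiv i Q)

/-- The polynomial divergence. -/
def divergence (P : Fin 3 → MvPolynomial (Fin 3) ℝ) : MvPolynomial (Fin 3) ℝ :=
  ∑ i, pderiv i (P i)

theorem laplacian_pderiv (i : Fin 3) (Q : MvPolynomial (Fin 3) ℝ) :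
    laplacian (pderiv i Q) = pderiv i (laplacian Q) := by
  simp only [laplacian, map_sum]
  exact Finset.sum_congr rfl fun j _ => by
    rw [pderiv_pderiv_comm j i, pderiv_pderiv_comm j i]

theorem euler {n : ℕ} {Q : MvPolynomial (Fin 3) ℝ} (hQ : Q.IsHomogeneous n) :
    X 0 * pderiv 0 Q + X 1 * pderiv 1 Q + X 2 * pderiv 2 Q = (n : MvPolynomial (Fin 3) ℝ) * Q := by
  rw [← nsmul_eq_mul, ← hQ.sum_X_mul_pderiv, Fin.sum_univ_three]

theorem euler_pderiv {n : ℕ} {Q : MvPolynomial (Fin 3) ℝ} (hQ : Q.IsHomogeneous n) (i : Fin 3) :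
    X 0 * pderiv 0 (pderiv i Q) + X 1 * pderiv 1 (pderiv i Q) + X 2 * pderiv 2 (pderiv i Q) =
      ((n : MvPolynomial (Fin 3) ℝ) - 1) * pderiv i Q := by
  have h := congrArg (pderiv i) (euler hQ)
  have hx : ∑ j, pderiv i (X j) * pderiv j Q = pderiv i Q := by
    simp [pderiv_X, Pi.single_apply]
  simp only [map_add, pderiv_mul, Derivation.map_natCast, Fin.sum_univ_three] at h hx
  rw [pderiv_pderiv_comm 0 i, pderiv_pderiv_comm 1 i, pderiv_pderiv_comm 2 i]
  linear_combination h - hx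

/-- The field `|x|² ∇Q - (2m+1) Q x`, the polynomial form of `|x|^{2m+3} ∇(|x|^{-(2m+1)} Q)`. -/
def field (m : ℕ) (Q : MvPolynomial (Fin 3) ℝ) (i : Fin 3) : MvPolynomial (Fin 3) ℝ :=
  normSq * pderiv i Q - (2 * (m : MvPolynomial (Fin 3) ℝ) + 1) * (X i * Q)

theorem field_isHomogeneous {m : ℕ} {Q : MvPolynomial (Fin 3) ℝ} (hQ : Q.IsHomogeneous m)
    (i : Fin 3) : (field m Q i).IsHomogeneous (m + 1) := by
  have h2 : ((2 * m + 1 : MvPolynomial (Fin 3) ℝ) * (X i * Q)).IsHomogeneous (m + 1) := by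
    have hC : (2 * m + 1 : MvPolynomial (Fin 3) ℝ) = C ((2 * m + 1 : ℕ) : ℝ) := by
      rw [map_natCast]; push_cast; rfl
    rw [hC, add_comm m]
    exact ((isHomogeneous_X ℝ i).mul hQ).C_mul _
  refine IsHomogeneous.sub ?_ h2
  rcases m with _ | m
  · have : pderiv i Q = 0 := by
      rw [totalDegree_eq_zero_iff_eq_C.mp (Nat.le_zero.mp hQ.totalDegree_le), pderiv_C]
    simpa [this] using isHomogeneous_zero _ _ _
  · have := normSq_isHomogeneous.mul (hQ.pderiv (i := i))
    rwa [show 2 + (m + 1 - 1) = m + 1 + 1 by omega] at this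

theorem pderiv_field (m : ℕ) (Q : MvPolynomial (Fin 3) ℝ) (i j : Fin 3) :
    pderiv j (field m Q i) = 2 * X j * pderiv i Q + normSq * pderiv j (pderiv i Q)
      - (2 * (m : MvPolynomial (Fin 3) ℝ) + 1) * (pderiv j (X i) * Q + X i * pderiv j Q) := by
  have h : pderiv j (2 * m + 1 : MvPolynomial (Fin 3) ℝ) = 0 := by
    exact_mod_cast (pderiv j).map_natCast (2 * m + 1)
  simp only [field, map_sub, pderiv_mul, pderiv_normSq, h]
  ring

theorem sum_X_mul_field {m : ℕ} {Q : MvPolynomial (Fin 3) ℝ} (hQ : Q.IsHomogeneous m) :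
    ∑ i, X i * field m Q i = -((m + 1) * (normSq * Q)) := by
  have hN : normSq = X 0 ^ 2 + X 1 ^ 2 + X 2 ^ 2 := by simp [normSq, Fin.sum_univ_three]
  simp only [field, Fin.sum_univ_three]
  linear_combination normSq * euler hQ + (2 * m + 1) * Q * hN

theorem divergence_field {m : ℕ} {Q : MvPolynomial (Fin 3) ℝ} (hQ : Q.IsHomogeneous m)
    (hΔ : laplacian Q = 0) :
    divergence (field m Q) = -((m + 1) * ((2 * m + 3) * Q)) := by
  simp only [laplacian, Fin.sum_univ_three] at hΔ
  simp only [divergence, pderiv_field, Fin.sum_univ_three, pderiv_X_self]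
  linear_combination normSq * hΔ + (1 - 2 * m) * euler hQ

theorem curl_field (m : ℕ) (Q : MvPolynomial (Fin 3) ℝ) (i j : Fin 3) :
    normSq * (pderiv i (field m Q j) - pderiv j (field m Q i)) =
      (2 * (m : MvPolynomial (Fin 3) ℝ) + 3) * (X i * field m Q j - X j * field m Q i) := by
  have hX : (pderiv i (X j) : MvPolynomial (Fin 3) ℝ) = pderiv j (X i) := by
    simp [pderiv_X, Pi.single_apply, eq_comm]
  rw [pderiv_field, pderiv_field, pderiv_pderiv_comm i j, hX]
  simp only [field]
  ring

theorem laplacian_field {m : ℕ} {Q : MvPolynomial (Fin 3) ℝ} (hQ : Q.IsHomogeneous m)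
    (hΔ : laplacian Q = 0) (i : Fin 3) : laplacian (field m Q i) = 0 := by
  have hX (j : Fin 3) : pderiv j (pderiv j (X i : MvPolynomial (Fin 3) ℝ)) = 0 := by
    rw [pderiv_X]
    by_cases h : j = i
    · subst h; simp
    · simp [Ne.symm h]
  have h2 : ∀ j, pderiv j (2 : MvPolynomial (Fin 3) ℝ) = 0 := fun j => by
    exact_mod_cast (pderiv j).map_natCast 2
  have h1 : ∀ j, pderiv j (2 * m + 1 : MvPolynomial (Fin 3) ℝ) = 0 := fun j => by
    exact_mod_cast (pderiv j).map_natCast (2 * m + 1)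
  have hx : ∑ j, pderiv j (X i) * pderiv j Q = pderiv i Q := by
    simp [pderiv_X, Pi.single_apply]
  have hΔi := laplacian_pderiv i Q
  rw [hΔ, map_zero] at hΔi
  simp only [laplacian, Fin.sum_univ_three] at hΔ hΔi hx ⊢
  simp only [pderiv_field, map_sub, map_add, pderiv_mul, pderiv_normSq, pderiv_X_self, h1, h2, hX]
  linear_combination 4 * euler_pderiv hQ i + normSq * hΔi - (2 * m + 1) * X i * hΔ
    - 2 * (2 * m + 1) * hx

theorem field_divergence {m : ℕ} {P : Fin 3 → MvPolynomial (Fin 3) ℝ}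
    (hP : ∀ i, (P i).IsHomogeneous (m + 1))
    (hdiv : normSq * divergence P = (2 * m + 3) * ∑ i, X i * P i)
    (hcurl : ∀ i j, normSq * (pderiv i (P j) - pderiv j (P i)) =
      (2 * (m : MvPolynomial (Fin 3) ℝ) + 3) * (X i * P j - X j * P i)) (i : Fin 3) :
    field m (divergence P) i = -((m + 1) * ((2 * m + 3) * P i)) := by
  have hN : normSq = X 0 ^ 2 + X 1 ^ 2 + X 2 ^ 2 := by simp [normSq, Fin.sum_univ_three]
  have hd := congrArg (pderiv i) hdiv
  have h3 : pderiv i (2 * m + 3 : MvPolynomial (Fin 3) ℝ) = 0 := by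
    exact_mod_cast (pderiv i).map_natCast (2 * m + 3)
  have hx : ∑ j, pderiv i (X j) * P j = P i := by
    simp [pderiv_X, Pi.single_apply]
  have he := euler (hP i)
  simp only [pderiv_mul, pderiv_normSq, h3, Fin.sum_univ_three, map_add] at hd hx hdiv
  refine mul_left_cancel₀ normSq_ne_zero ?_
  simp only [field]
  push_cast at he
  linear_combination normSq * hd + (2 * m + 3) * normSq * hx + (2 * m + 3) * normSq * he
    + (2 * m + 3) * (X 0 * hcurl i 0 + X 1 * hcurl i 1 + X 2 * hcurl i 2)
    - (2 * m + 3) * X i * hdiv + (2 * m + 3) ^ 2 * P i * hN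

theorem eq_zero_of_field_eq_zero {m : ℕ} {Q : MvPolynomial (Fin 3) ℝ} (hQ : Q.IsHomogeneous m)
    (h : ∀ i, field m Q i = 0) : Q = 0 := by
  have := sum_X_mul_field hQ
  simp only [h, mul_zero, Finset.sum_const_zero] at this
  have hm : (m + 1 : MvPolynomial (Fin 3) ℝ) ≠ 0 := by exact_mod_cast Nat.succ_ne_zero m
  simpa [normSq_ne_zero, hm] using this

theorem eval_normSq (x : V3) : eval x normSq = dot3 x x := by
  simp [normSq, dot3, sq]

theorem constantCoeff_normSq : constantCoeff normSq = 0 := by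
  simp [normSq]

theorem dot3_self_pos {x : V3} (hx : x ≠ 0) : 0 < dot3 x x := by
  obtain ⟨i, hi⟩ := Function.ne_iff.mp hx
  exact Finset.sum_pos' (fun j _ => mul_self_nonneg _) ⟨i, Finset.mem_univ i, mul_self_pos.mpr hi⟩

theorem norm3_pos {x : V3} (hx : x ≠ 0) : 0 < norm3 x := Real.sqrt_pos.mpr (dot3_self_pos hx)

theorem norm3_sq (x : V3) : norm3 x ^ 2 = dot3 x x :=
  Real.sq_sqrt (Finset.sum_nonneg fun _ _ => mul_self_nonneg _)

theorem eq_of_forall_ne_zero_eval_eq {F G : MvPolynomial (Fin 3) ℝ}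
    (h : ∀ x : V3, x ≠ 0 → eval x F = eval x G) : F = G := by
  refine mul_left_cancel₀ normSq_ne_zero (MvPolynomial.funext fun x => ?_)
  by_cases hx : x = 0
  · rw [map_mul, map_mul, eval_normSq, hx]
    simp [dot3]
  · rw [map_mul, map_mul, h x hx]

theorem hasFDerivAt_eval (Q : MvPolynomial (Fin 3) ℝ) (x : V3) :
    HasFDerivAt (fun y : V3 => eval y Q)
      (∑ i, eval x (pderiv i Q) • ContinuousLinearMap.proj (R := ℝ) (φ := fun _ => ℝ) i) x := by
  induction Q using MvPolynomial.induction_on with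
  | C a => simpa using hasFDerivAt_const a x
  | add p q hp hq =>
    simp only [map_add, add_smul, Finset.sum_add_distrib]
    exact hp.add hq
  | mul_X p j hp =>
    have hj : HasFDerivAt (fun y : V3 => y j)
        (ContinuousLinearMap.proj (R := ℝ) (φ := fun _ => ℝ) j) x := hasFDerivAt_apply j x
    have h := hp.mul hj
    simp only [map_mul, eval_X]
    refine h.congr_fderiv ?_
    ext v
    have hx : ∑ i, eval x (if j = i then p else 0) * v i = eval x p * v j := by
      simp [apply_ite]
    simp [pderiv_X, Pi.single_apply, add_mul, Finset.sum_add_distrib, Finset.mul_sum, hx,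
      mul_assoc]

theorem pd_eval (i : Fin 3) (Q : MvPolynomial (Fin 3) ℝ) :
    pd i (fun y => eval y Q) = fun x => eval x (pderiv i Q) := by
  funext x
  simp [pd, (hasFDerivAt_eval Q x).fderiv, Pi.single_apply]

theorem isHarmonic_eval_iff (Q : MvPolynomial (Fin 3) ℝ) :
    IsHarmonic (fun y => eval y Q) ↔ laplacian Q = 0 := by
  simp only [IsHarmonic, pd_eval, ← map_sum]
  exact ⟨fun h => MvPolynomial.funext fun x => by simpa [laplacian] using h x, fun h x => by
    simpa [laplacian] using congrArg (eval x) h⟩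

theorem mem_Pk_iff {k : ℕ} {f : V3 → ℝ} :
    f ∈ Pk k ↔ ∃ Q : MvPolynomial (Fin 3) ℝ,
      Q.IsHomogeneous k ∧ laplacian Q = 0 ∧ f = fun x => eval x Q := by
  constructor
  · rintro ⟨⟨Q, hQ, hf⟩, hΔ⟩
    obtain rfl : f = fun x => eval x Q := funext hf
    exact ⟨Q, hQ, (isHarmonic_eval_iff Q).mp hΔ, rfl⟩
  · rintro ⟨Q, hQ, hΔ, rfl⟩
    exact ⟨⟨Q, hQ, fun _ => rfl⟩, (isHarmonic_eval_iff Q).mpr hΔ⟩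

theorem pd_norm3_pow_inv_mul_eval (n : ℕ) (i : Fin 3) (Q : MvPolynomial (Fin 3) ℝ) {x : V3}
    (hx : x ≠ 0) :
    pd i (fun y => (norm3 y ^ n)⁻¹ * eval y Q) x =
      (norm3 x ^ n)⁻¹ * (eval x (pderiv i Q) - n * x i * eval x Q / dot3 x x) := by
  have hN := hasFDerivAt_eval normSq x
  simp only [eval_normSq] at hN
  have hs := norm3_pos hx
  have h1 := hN.sqrt (dot3_self_pos hx).ne'
  have h2 := ((hasDerivAt_pow n (norm3 x)).inv (pow_pos hs n).ne').comp_hasFDerivAt x h1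
  have h3 := h2.mul (hasFDerivAt_eval Q x)
  have h4 : fderiv ℝ (fun y => (norm3 y ^ n)⁻¹ * eval y Q) x = _ := h3.fderiv
  rw [pd, h4]
  simp only [Function.comp_def, Pi.inv_apply]
  rw [← norm3_sq]
  simp [pderiv_normSq, Pi.single_apply]
  rw [Real.sqrt_sq hs.le]
  rcases n with _ | n
  · simp
  · simp only [Nat.add_sub_cancel]
    field_simp
    ring

theorem wkpMap_eval (m : ℕ) (Q : MvPolynomial (Fin 3) ℝ) :
    wkpMap (m + 1) (fun y => eval y Q) = fun x i => eval x (field m Q i) := by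
  funext x i
  by_cases hx : x = 0
  · subst hx
    simp [wkpMap, field, constantCoeff_normSq, norm3, dot3]
  · have hs := norm3_pos hx
    simp only [wkpMap, grad3, Pi.smul_apply, smul_eq_mul]
    unfold kelvinPotential
    rw [pd_norm3_pow_inv_mul_eval _ _ _ hx]
    simp only [field, map_sub, map_mul, map_add, map_natCast, map_ofNat, map_one, eval_X,
      eval_normSq, ← norm3_sq]
    rw [show 2 * (m + 1) - 1 = 2 * m + 1 by omega]
    push_cast
    field_simp
    ring

theorem kelvin_wkpMap (k : ℕ) (q : V3 → ℝ) {x : V3} (hx : x ≠ 0) :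
    kelvin k (wkpMap k q) x = grad3 (kelvinPotential k q) x :=
  inv_smul_smul₀ (pow_pos (norm3_pos hx) _).ne' _

theorem pd_kelvin_eval (k : ℕ) (P : Fin 3 → MvPolynomial (Fin 3) ℝ) (i j : Fin 3) {x : V3}
    (hx : x ≠ 0) :
    pd j (fun y => kelvin k (fun z l => eval z (P l)) y i) x =
      (norm3 x ^ (2 * k + 1) * dot3 x x)⁻¹ *
        eval x (normSq * pderiv j (P i) - (2 * (k : MvPolynomial (Fin 3) ℝ) + 1) * (X j * P i)) := by
  have h := pd_norm3_pow_inv_mul_eval (2 * k + 1) j (P i) hx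
  have hd := (dot3_self_pos hx).ne'
  have hs := (norm3_pos hx).ne'
  simp only [kelvin, Pi.smul_apply, smul_eq_mul]
  rw [h]
  simp only [map_sub, map_mul, map_add, map_natCast, map_ofNat, map_one, eval_X, eval_normSq]
  push_cast
  field_simp

theorem div3_kelvin_eval_eq_zero_iff (k : ℕ) (P : Fin 3 → MvPolynomial (Fin 3) ℝ) :
    (∀ x : V3, x ≠ 0 → div3 (kelvin k fun z l => eval z (P l)) x = 0) ↔
      normSq * divergence P = (2 * (k : MvPolynomial (Fin 3) ℝ) + 1) * ∑ i, X i * P i := by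
  have key {x : V3} (hx : x ≠ 0) : div3 (kelvin k fun z l => eval z (P l)) x = 0 ↔
      eval x (normSq * divergence P) =
        eval x ((2 * (k : MvPolynomial (Fin 3) ℝ) + 1) * ∑ i, X i * P i) := by
    have hc : (norm3 x ^ (2 * k + 1) * dot3 x x)⁻¹ ≠ 0 :=
      inv_ne_zero (mul_ne_zero (pow_pos (norm3_pos hx) _).ne' (dot3_self_pos hx).ne')
    simp only [div3, pd_kelvin_eval k P _ _ hx]
    rw [← Finset.mul_sum, mul_eq_zero_iff_left hc, ← map_sum, Finset.sum_sub_distrib,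
      ← Finset.mul_sum, ← Finset.mul_sum, map_sub, sub_eq_zero, divergence]
  exact ⟨fun h => eq_of_forall_ne_zero_eval_eq fun x hx => (key hx).mp (h x hx),
    fun h x hx => (key hx).mpr (congrArg _ h)⟩

theorem curl3_kelvin_eval_eq_zero_iff (k : ℕ) (P : Fin 3 → MvPolynomial (Fin 3) ℝ) :
    (∀ x : V3, x ≠ 0 → curl3 (kelvin k fun z l => eval z (P l)) x = 0) ↔
      ∀ i j, normSq * (pderiv i (P j) - pderiv j (P i)) =
        (2 * (k : MvPolynomial (Fin 3) ℝ) + 1) * (X i * P j - X j * P i) := by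
  have key {x : V3} (hx : x ≠ 0) (i j : Fin 3) :
      pd i (fun y => kelvin k (fun z l => eval z (P l)) y j) x -
        pd j (fun y => kelvin k (fun z l => eval z (P l)) y i) x = 0 ↔
      eval x (normSq * (pderiv i (P j) - pderiv j (P i))) =
        eval x ((2 * (k : MvPolynomial (Fin 3) ℝ) + 1) * (X i * P j - X j * P i)) := by
    have hc : (norm3 x ^ (2 * k + 1) * dot3 x x)⁻¹ ≠ 0 :=
      inv_ne_zero (mul_ne_zero (pow_pos (norm3_pos hx) _).ne' (dot3_self_pos hx).ne')
    rw [pd_kelvin_eval k P _ _ hx, pd_kelvin_eval k P _ _ hx, ← mul_sub,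
      mul_eq_zero_iff_left hc, ← sub_eq_zero (a := eval x (normSq * _))]
    simp only [← map_sub]
    ring_nf
  constructor
  · intro h
    have h' (i : Fin 3) := eq_of_forall_ne_zero_eval_eq fun x hx =>
      (key hx (i + 1) (i + 2)).mp (congrFun (h x hx) i)
    have h0 := h' 0
    have h1 := h' 1
    have h2 := h' 2
    simp only [Fin.reduceAdd, zero_add] at h0 h1 h2
    intro i j
    fin_cases i <;> fin_cases j <;>
      simp only [Fin.zero_eta, Fin.mk_one, Fin.reduceFinMk, sub_self, mul_zero]
    · linear_combination h2
    · linear_combination -h1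
    · linear_combination -h2
    · linear_combination h0
    · linear_combination h1
    · linear_combination -h0
  · intro h x hx
    funext i
    exact (key hx _ _).mpr (congrArg _ (h _ _))

theorem wkpMap_mem_Wkp {m : ℕ} {q : V3 → ℝ} (hq : q ∈ Pk m) : wkpMap (m + 1) q ∈ Wkp (m + 1) := by
  obtain ⟨Q, hQ, hΔ, rfl⟩ := mem_Pk_iff.mp hq
  rw [wkpMap_eval]
  refine ⟨fun i => mem_Pk_iff.mpr
    ⟨field m Q i, field_isHomogeneous hQ i, laplacian_field hQ hΔ i, rfl⟩, ?_, ?_⟩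
  · rw [div3_kelvin_eval_eq_zero_iff, divergence_field hQ hΔ, sum_X_mul_field hQ]
    push_cast
    ring
  · rw [curl3_kelvin_eval_eq_zero_iff]
    intro i j
    rw [curl_field]
    push_cast
    ring

theorem wkpMap_injOn (m : ℕ) : Set.InjOn (wkpMap (m + 1)) (Pk m) := by
  intro q hq q' hq' h
  obtain ⟨Q, hQ, -, rfl⟩ := mem_Pk_iff.mp hq
  obtain ⟨Q', hQ', -, rfl⟩ := mem_Pk_iff.mp hq'
  rw [wkpMap_eval, wkpMap_eval] at h
  have : Q - Q' = 0 := eq_zero_of_field_eq_zero (hQ.sub hQ') fun i => by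
    have hi : field m Q i = field m Q' i :=
      MvPolynomial.funext fun x => congrFun (congrFun h x) i
    have hs : field m (Q - Q') i = field m Q i - field m Q' i := by
      simp only [field, map_sub]
      ring
    rw [hs, hi, sub_self]
  rw [sub_eq_zero.mp this]

theorem field_C_mul (m : ℕ) (c : ℝ) (Q : MvPolynomial (Fin 3) ℝ) (i : Fin 3) :
    field m (C c * Q) i = C c * field m Q i := by
  simp only [field, pderiv_C_mul]
  ring

theorem laplacian_C_mul (c : ℝ) (Q : MvPolynomial (Fin 3) ℝ) :
    laplacian (C c * Q) = C c * laplacian Q := by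
  simp only [laplacian, pderiv_C_mul, Finset.mul_sum]

theorem wkpMap_surjOn (m : ℕ) : Set.SurjOn (wkpMap (m + 1)) (Pk m) (Wkp (m + 1)) := by
  rintro p ⟨hp, hdiv, hcurl⟩
  choose P hP hΔ hpP using fun i => mem_Pk_iff.mp (hp i)
  obtain rfl : p = fun x i => eval x (P i) := funext fun x => funext fun i => congrFun (hpP i) x
  rw [div3_kelvin_eval_eq_zero_iff] at hdiv
  rw [curl3_kelvin_eval_eq_zero_iff] at hcurl
  have h3 : 2 * ((m + 1 : ℕ) : MvPolynomial (Fin 3) ℝ) + 1 = 2 * m + 3 := by push_cast; ring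
  rw [h3] at hdiv
  simp only [h3] at hcurl
  set c : ℝ := -(((m : ℝ) + 1) * (2 * m + 3))⁻¹ with hc
  have hdivΔ : laplacian (divergence P) = 0 := by
    have h (i : Fin 3) : laplacian (pderiv i (P i)) = 0 := by
      rw [laplacian_pderiv, hΔ, map_zero]
    simp only [laplacian, Fin.sum_univ_three] at h
    simp only [laplacian, divergence, Fin.sum_univ_three, map_add]
    linear_combination h 0 + h 1 + h 2
  refine ⟨fun x => eval x (C c * divergence P), mem_Pk_iff.mpr ⟨_, ?_, ?_, rfl⟩, ?_⟩
  · exact (IsHomogeneous.sum _ _ _ fun i _ => (hP i).pderiv).C_mul c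
  · rw [laplacian_C_mul, hdivΔ, mul_zero]
  · rw [wkpMap_eval]
    funext x i
    rw [field_C_mul, field_divergence hP hdiv hcurl]
    simp only [map_neg, map_mul, map_add, map_natCast, map_ofNat, map_one, eval_C, hc]
    have h1 : (m + 1 : ℝ) ≠ 0 := by positivity
    have h2 : (2 * m + 3 : ℝ) ≠ 0 := by positivity
    field_simp

theorem wkpMap_add {m : ℕ} {q q' : V3 → ℝ} (hq : q ∈ Pk m) (hq' : q' ∈ Pk m) :
    wkpMap (m + 1) (q + q') = wkpMap (m + 1) q + wkpMap (m + 1) q' := by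
  obtain ⟨Q, -, -, rfl⟩ := mem_Pk_iff.mp hq
  obtain ⟨Q', -, -, rfl⟩ := mem_Pk_iff.mp hq'
  have h : (fun y : V3 => eval y Q) + (fun y => eval y Q') = fun y => eval y (Q + Q') := by
    funext y
    simp
  rw [h, wkpMap_eval, wkpMap_eval, wkpMap_eval]
  funext x i
  simp only [field, map_add, Pi.add_apply, map_sub, map_mul]
  ring

theorem wkpMap_smul {m : ℕ} (c : ℝ) {q : V3 → ℝ} (hq : q ∈ Pk m) :
    wkpMap (m + 1) (c • q) = c • wkpMap (m + 1) q := by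
  obtain ⟨Q, -, -, rfl⟩ := mem_Pk_iff.mp hq
  have h : (c • fun y : V3 => eval y Q) = fun y => eval y (C c * Q) := by
    funext y
    simp
  rw [h, wkpMap_eval, wkpMap_eval]
  funext x i
  simp [field_C_mul]

end KelvinField

/-- For `k ≥ 1`, the map `q ↦ |x|^{2k+1} ∇(|x|^{-(2k-1)} q(x))` is a linear
isomorphism from `P_{k-1}` onto `W_k^+`; in particular, for `q ∈ P_{k-1}` its image `p` lies
in `P_k³` and its Kelvin transform `p* = ∇(|x|^{-(2k-1)} q)` is divergence free and curl free
on `ℝ³ \ {0}` (membership in `W_k^+`). -/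
theorem wkpMap_linear_iso (k : ℕ) (hk : 1 ≤ k) :
    (∀ q ∈ Pk (k - 1), wkpMap k q ∈ Wkp k) ∧
    (∀ q ∈ Pk (k - 1), ∀ x : V3, x ≠ 0 →
      kelvin k (wkpMap k q) x = grad3 (kelvinPotential k q) x) ∧
    (∀ q ∈ Pk (k - 1), ∀ q' ∈ Pk (k - 1), wkpMap k q = wkpMap k q' → q = q') ∧
    (∀ p ∈ Wkp k, ∃ q ∈ Pk (k - 1), wkpMap k q = p) ∧
    (∀ q ∈ Pk (k - 1), ∀ q' ∈ Pk (k - 1), wkpMap k (q + q') = wkpMap k q + wkpMap k q') ∧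
    (∀ (c : ℝ), ∀ q ∈ Pk (k - 1), wkpMap k (c • q) = c • wkpMap k q) := by
  obtain ⟨m, rfl⟩ := Nat.exists_eq_add_of_le' hk
  rw [Nat.add_sub_cancel]
  exact ⟨fun q hq => KelvinField.wkpMap_mem_Wkp hq,
    fun q _ x hx => KelvinField.kelvin_wkpMap (m + 1) q hx,
    fun q hq q' hq' h => KelvinField.wkpMap_injOn m hq hq' h,
    fun p hp => KelvinField.wkpMap_surjOn m hp,
    fun q hq q' hq' => KelvinField.wkpMap_add hq hq',
    fun c q hq => KelvinField.wkpMap_smul c hq⟩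
end
end

section
/- For every integer k ≥ 1 the subspaces of P_k³ have dimensions dim W_k^o = 2k+1, dim W_k^− = 2k+3, and dim W_k^+ = 2k−1. -/
noncomputable section

open scoped BigOperators

namespace HarmonicField

open MvPolynomial

/-- Real polynomials in three variables. -/
abbrev Poly : Type := MvPolynomial (Fin 3) ℝ

theorem pderiv_comm (i j : Fin 3) (f : Poly) :
    pderiv i (pderiv j f) = pderiv j (pderiv i f) := by
  have h : ⁅(pderiv i : Derivation ℝ Poly Poly), (pderiv j : Derivation ℝ Poly Poly)⁆ = 0 := by
    apply derivation_ext
    intro l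
    rw [Derivation.commutator_apply]
    simp only [pderiv_X, Pi.single_apply]
    split_ifs <;> simp
  have h' := congrArg (fun D : Derivation ℝ Poly Poly => D f) h
  simpa [Derivation.commutator_apply, sub_eq_zero] using h'

/-- The Laplacian on polynomials. -/
def laplacian : Poly →ₗ[ℝ] Poly :=
  ∑ i : Fin 3, (pderiv i).toLinearMap ∘ₗ (pderiv i).toLinearMap

theorem laplacian_apply (f : Poly) :
    laplacian f = pderiv 0 (pderiv 0 f) + pderiv 1 (pderiv 1 f) + pderiv 2 (pderiv 2 f) := by
  simp [laplacian, Fin.sum_univ_three]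

theorem laplacian_pderiv (i : Fin 3) (f : Poly) :
    laplacian (pderiv i f) = pderiv i (laplacian f) := by
  simp only [laplacian_apply, map_add]
  simp only [pderiv_comm _ i]

theorem isHomogeneous_laplacian {n : ℕ} {f : Poly} (hf : f.IsHomogeneous (n + 2)) :
    (laplacian f).IsHomogeneous n := by
  rw [laplacian_apply]
  exact ((hf.pderiv.pderiv).add hf.pderiv.pderiv).add hf.pderiv.pderiv

theorem pderiv_eq_zero_of_isHomogeneous_zero {f : Poly} (hf : f.IsHomogeneous 0) (i : Fin 3) :
    pderiv i f = 0 := by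
  rw [← totalDegree_zero_iff_isHomogeneous, totalDegree_eq_zero_iff_eq_C] at hf
  rw [hf, pderiv_C]

theorem laplacian_eq_zero_of_lt_two {n : ℕ} (hn : n < 2) {f : Poly} (hf : f.IsHomogeneous n) :
    laplacian f = 0 := by
  have h (i : Fin 3) : pderiv i (pderiv i f) = 0 := by
    have h0 := hf.pderiv (i := i)
    rw [show n - 1 = 0 by omega] at h0
    exact pderiv_eq_zero_of_isHomogeneous_zero h0 i
  simp [laplacian_apply, h]

theorem exists_laplacian_eq_monomial (s : ℕ) : ∀ a b c : ℕ, a + b = s →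
    ∃ f : Poly, f.IsHomogeneous (a + b + c + 2) ∧ laplacian f = X 0 ^ a * X 1 ^ b * X 2 ^ c := by
  induction s using Nat.strong_induction_on with
  | _ s ih =>
  intro a b c hs
  obtain ⟨f, hf, hf'⟩ : ∃ f : Poly, f.IsHomogeneous (a + b + c + 2) ∧
      laplacian f = ((a : Poly) * ((a - 1 : ℕ) : Poly)) * (X 0 ^ (a - 1 - 1) * X 1 ^ b * X 2 ^ (c + 2)) := by
    rcases lt_or_ge a 2 with ha | ha
    · refine ⟨0, isHomogeneous_zero _ _ _, ?_⟩
      interval_cases a <;> simp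
    · obtain ⟨f, hf, hf'⟩ := ih (a - 2 + b) (by omega) (a - 2) b (c + 2) rfl
      refine ⟨((a * (a - 1 : ℕ) : ℕ) : ℝ) • f, ?_, ?_⟩
      · rw [show a + b + c + 2 = a - 2 + b + (c + 2) + 2 by omega]
        exact Submodule.smul_mem (homogeneousSubmodule (Fin 3) ℝ _) _ hf
      · rw [map_smul, hf', smul_eq_C_mul, show a - 1 - 1 = a - 2 by omega]
        simp
  obtain ⟨g, hg, hg'⟩ : ∃ f : Poly, f.IsHomogeneous (a + b + c + 2) ∧
      laplacian f = ((b : Poly) * ((b - 1 : ℕ) : Poly)) * (X 0 ^ a * X 1 ^ (b - 1 - 1) * X 2 ^ (c + 2)) := by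
    rcases lt_or_ge b 2 with hb | hb
    · refine ⟨0, isHomogeneous_zero _ _ _, ?_⟩
      interval_cases b <;> simp
    · obtain ⟨f, hf, hf'⟩ := ih (a + (b - 2)) (by omega) a (b - 2) (c + 2) rfl
      refine ⟨((b * (b - 1 : ℕ) : ℕ) : ℝ) • f, ?_, ?_⟩
      · rw [show a + b + c + 2 = a + (b - 2) + (c + 2) + 2 by omega]
        exact Submodule.smul_mem (homogeneousSubmodule (Fin 3) ℝ _) _ hf
      · rw [map_smul, hf', smul_eq_C_mul, show b - 1 - 1 = b - 2 by omega]
        simp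
  have hX : (X 0 ^ a * X 1 ^ b * X 2 ^ (c + 2) : Poly).IsHomogeneous (a + b + c + 2) := by
    have := ((isHomogeneous_X_pow (R := ℝ) (0 : Fin 3) a).mul
      (isHomogeneous_X_pow (1 : Fin 3) b)).mul (isHomogeneous_X_pow (2 : Fin 3) (c + 2))
    exact this
  have hL : laplacian (X 0 ^ a * X 1 ^ b * X 2 ^ (c + 2) : Poly) =
      ((a : Poly) * ((a - 1 : ℕ) : Poly)) * (X 0 ^ (a - 1 - 1) * X 1 ^ b * X 2 ^ (c + 2)) +
      ((b : Poly) * ((b - 1 : ℕ) : Poly)) * (X 0 ^ a * X 1 ^ (b - 1 - 1) * X 2 ^ (c + 2)) +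
      (((c : Poly) + 2) * ((c : Poly) + 1)) * (X 0 ^ a * X 1 ^ b * X 2 ^ c) := by
    have h2 : pderiv 2 (2 : Poly) = 0 := (pderiv 2 : Derivation ℝ Poly Poly).map_natCast 2
    simp [laplacian_apply, Derivation.leibniz, Derivation.leibniz_pow, pderiv_X, h2]
    ring
  refine ⟨((c + 2) * (c + 1) : ℝ)⁻¹ • (X 0 ^ a * X 1 ^ b * X 2 ^ (c + 2) - f - g), ?_, ?_⟩
  · exact Submodule.smul_mem (homogeneousSubmodule (Fin 3) ℝ _) _ ((hX.sub hf).sub hg)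
  · have hc : ((c + 2) * (c + 1) : ℝ) ≠ 0 := by positivity
    rw [map_smul, map_sub, map_sub, hL, hf', hg', inv_smul_eq_iff₀ hc, smul_eq_C_mul]
    simp only [map_mul, map_add, map_natCast, map_one, map_ofNat]
    ring

theorem exists_laplacian_eq {n : ℕ} {g : Poly} (hg : g.IsHomogeneous n) :
    ∃ f : Poly, f.IsHomogeneous (n + 2) ∧ laplacian f = g := by
  suffices h : homogeneousSubmodule (Fin 3) ℝ n ≤
      (homogeneousSubmodule (Fin 3) ℝ (n + 2)).map laplacian from h hg
  rw [homogeneousSubmodule_eq_finsupp_supported, ← restrictSupport, restrictSupport_eq_span,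
    Submodule.span_le]
  rintro _ ⟨d, hd, rfl⟩
  obtain ⟨f, hf, hf'⟩ := exists_laplacian_eq_monomial _ (d 0) (d 1) (d 2) rfl
  have hd' : d 0 + d 1 + d 2 = n := by
    rw [← Fin.sum_univ_three, ← Finsupp.degree_eq_sum]; exact hd
  refine ⟨f, hd' ▸ hf, ?_⟩
  simp [hf', monomial_eq, Finsupp.prod_fintype, Fin.prod_univ_three]

/-- Homogeneous harmonic polynomials of degree `n`. -/
def harmonic (n : ℕ) : Submodule ℝ Poly :=
  homogeneousSubmodule (Fin 3) ℝ n ⊓ LinearMap.ker laplacian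

theorem mem_harmonic {n : ℕ} {f : Poly} :
    f ∈ harmonic n ↔ f.IsHomogeneous n ∧ laplacian f = 0 := Iff.rfl

instance (n : ℕ) : FiniteDimensional ℝ (homogeneousSubmodule (Fin 3) ℝ n) :=
  Module.Finite.iff_fg.mpr (homogeneousSubmodule_fg _ _ n)

instance (n : ℕ) : FiniteDimensional ℝ (harmonic n) :=
  Submodule.finiteDimensional_of_le (inf_le_left (b := LinearMap.ker laplacian))

theorem finrank_homogeneousSubmodule (n : ℕ) :
    Module.finrank ℝ (homogeneousSubmodule (Fin 3) ℝ n) = (n + 2).choose 2 := by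
  have hset : {d : Fin 3 →₀ ℕ | d.degree = n} =
      ((Finset.univ : Finset (Fin 3)).finsuppAntidiag n : Set (Fin 3 →₀ ℕ)) := by
    ext d
    simp [Finsupp.degree_eq_sum]
  rw [homogeneousSubmodule_eq_finsupp_supported, ← restrictSupport, hset,
    Module.finrank_eq_card_basis (basisRestrictSupport ℝ _)]
  simp only [Finset.coe_sort_coe, Fintype.card_coe, Finset.card_finsuppAntidiag_nat_eq_choose,
    Finset.card_univ, Fintype.card_fin]
  rw [show 3 + n - 1 = n + 2 by omega]
  exact Nat.choose_symm_add

theorem finrank_harmonic (n : ℕ) : Module.finrank ℝ (harmonic n) = 2 * n + 1 := by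
  rcases lt_or_ge n 2 with hn | hn
  · have h : harmonic n = homogeneousSubmodule (Fin 3) ℝ n :=
      inf_eq_left.mpr fun f hf => laplacian_eq_zero_of_lt_two hn hf
    rw [h, finrank_homogeneousSubmodule]
    interval_cases n <;> rfl
  · obtain ⟨n, rfl⟩ := Nat.exists_eq_add_of_le' hn
    let L : homogeneousSubmodule (Fin 3) ℝ (n + 2) →ₗ[ℝ] homogeneousSubmodule (Fin 3) ℝ n :=
      laplacian.restrict fun f hf => isHomogeneous_laplacian hf
    have hL : Function.Surjective L := fun ⟨g, hg⟩ => by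
      obtain ⟨f, hf, hf'⟩ := exists_laplacian_eq hg
      exact ⟨⟨f, hf⟩, Subtype.ext hf'⟩
    have hker : LinearMap.ker L = Submodule.comap (Submodule.subtype _) (harmonic (n + 2)) := by
      ext f
      rw [LinearMap.mem_ker, Subtype.ext_iff]
      exact ⟨fun h => ⟨f.2, h⟩, fun h => h.2⟩
    have h := L.finrank_range_add_finrank_ker
    rw [LinearMap.range_eq_top.mpr hL, finrank_top, hker,
      (Submodule.comapSubtypeEquivOfLe (show harmonic (n + 2) ≤ _ from inf_le_left)).finrank_eq,
      finrank_homogeneousSubmodule, finrank_homogeneousSubmodule] at h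
    have h1 : (n + 2 + 2).choose 2 = (n + 2).choose 2 + 2 * (n + 2) + 1 := by
      rw [Nat.choose_succ_succ' (n + 3) 1, Nat.choose_succ_succ' (n + 2) 1]
      simp only [Nat.choose_one_right, Nat.reduceAdd]
      omega
    omega

theorem euler {n : ℕ} {f : Poly} (hf : f.IsHomogeneous n) :
    X 0 * pderiv 0 f + X 1 * pderiv 1 f + X 2 * pderiv 2 f = (n : Poly) * f := by
  have h := hf.sum_X_mul_pderiv
  rwa [Fin.sum_univ_three, nsmul_eq_mul] at h

theorem pderiv_natCast_mul (i : Fin 3) (n : ℕ) (f : Poly) :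
    pderiv i ((n : Poly) * f) = (n : Poly) * pderiv i f := by
  simp [Derivation.leibniz]

theorem euler_pderiv {n : ℕ} {f : Poly} (hf : f.IsHomogeneous n) (i : Fin 3) :
    X 0 * pderiv 0 (pderiv i f) + X 1 * pderiv 1 (pderiv i f) + X 2 * pderiv 2 (pderiv i f) =
      (n : Poly) * pderiv i f - pderiv i f := by
  have h := congrArg (pderiv i) (euler hf)
  rw [pderiv_natCast_mul] at h
  rw [← h]
  simp only [pderiv_comm _ i]
  fin_cases i <;> simp [Derivation.leibniz, pderiv_X] <;> ring

theorem laplacian_X_mul (i : Fin 3) (f : Poly) :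
    laplacian (X i * f) = X i * laplacian f + 2 * pderiv i f := by
  fin_cases i <;> simp [laplacian_apply, Derivation.leibniz, pderiv_X] <;> ring

/-- The squared Euclidean norm, as a polynomial. -/
def normSq : Poly := X 0 ^ 2 + X 1 ^ 2 + X 2 ^ 2

theorem normSq_ne_zero : normSq ≠ 0 := fun h => by
  have := congrArg (eval fun _ => (1 : ℝ)) h
  norm_num [normSq] at this

theorem isHomogeneous_normSq : normSq.IsHomogeneous 2 :=
  ((isHomogeneous_X_pow _ _).add (isHomogeneous_X_pow _ _)).add (isHomogeneous_X_pow _ _)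

theorem pderiv_normSq (i : Fin 3) : pderiv i normSq = 2 * X i := by
  fin_cases i <;> simp [normSq, Derivation.leibniz_pow, pderiv_X]

theorem laplacian_normSq_mul (f : Poly) :
    laplacian (normSq * f) = normSq * laplacian f + 6 * f +
      4 * (X 0 * pderiv 0 f + X 1 * pderiv 1 f + X 2 * pderiv 2 f) := by
  have h2 (i : Fin 3) : pderiv i (2 : Poly) = 0 :=
    (pderiv i : Derivation ℝ Poly Poly).map_natCast 2
  simp [laplacian_apply, Derivation.leibniz, pderiv_normSq, h2]
  ring

/-- Divergence of a polynomial vector field. -/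
def divergence (q : Fin 3 → Poly) : Poly := ∑ i, pderiv i (q i)

/-- Curl of a polynomial vector field. -/
def curl (q : Fin 3 → Poly) (i : Fin 3) : Poly :=
  pderiv (i + 1) (q (i + 2)) - pderiv (i + 2) (q (i + 1))

theorem divergence_eq (q : Fin 3 → Poly) :
    divergence q = pderiv 0 (q 0) + pderiv 1 (q 1) + pderiv 2 (q 2) := by
  simp [divergence, Fin.sum_univ_three]

theorem curl_zero (q : Fin 3 → Poly) : curl q 0 = pderiv 1 (q 2) - pderiv 2 (q 1) := rfl

theorem curl_one (q : Fin 3 → Poly) : curl q 1 = pderiv 2 (q 0) - pderiv 0 (q 2) := rfl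

theorem curl_two (q : Fin 3 → Poly) : curl q 2 = pderiv 0 (q 1) - pderiv 1 (q 0) := rfl

/-- The gradient `∇h`. -/
def gradient : Poly →ₗ[ℝ] (Fin 3 → Poly) := LinearMap.pi fun i => (pderiv i).toLinearMap

/-- The tangential field `x × ∇h`. -/
def rotation : Poly →ₗ[ℝ] (Fin 3 → Poly) := LinearMap.pi fun i =>
  LinearMap.mulLeft ℝ (X (i + 1)) ∘ₗ (pderiv (i + 2)).toLinearMap -
    LinearMap.mulLeft ℝ (X (i + 2)) ∘ₗ (pderiv (i + 1)).toLinearMap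

/-- The field `|x|² ∇h - (2n+1) x h`, which is the Kelvin transform of the gradient of the Kelvin
transform of `h` when `h` is homogeneous of degree `n`. -/
def exterior (n : ℕ) : Poly →ₗ[ℝ] (Fin 3 → Poly) := LinearMap.pi fun i =>
  LinearMap.mulLeft ℝ normSq ∘ₗ (pderiv i).toLinearMap -
    LinearMap.mulLeft ℝ (((2 * n + 1 : ℕ) : Poly) * X i)

theorem gradient_apply (h : Poly) (i : Fin 3) : gradient h i = pderiv i h := rfl

theorem rotation_apply (h : Poly) (i : Fin 3) :
    rotation h i = X (i + 1) * pderiv (i + 2) h - X (i + 2) * pderiv (i + 1) h := rfl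

theorem rotation_zero (h : Poly) : rotation h 0 = X 1 * pderiv 2 h - X 2 * pderiv 1 h := rfl

theorem rotation_one (h : Poly) : rotation h 1 = X 2 * pderiv 0 h - X 0 * pderiv 2 h := rfl

theorem rotation_two (h : Poly) : rotation h 2 = X 0 * pderiv 1 h - X 1 * pderiv 0 h := rfl

theorem exterior_apply (n : ℕ) (h : Poly) (i : Fin 3) :
    exterior n h i = normSq * pderiv i h - ((2 * n + 1 : ℕ) : Poly) * X i * h := rfl

/-- The normal component `x · q`. -/
def radial (q : Fin 3 → Poly) : Poly := ∑ i, X i * q i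

/-- The cross product `x × q`. -/
def crossX (q : Fin 3 → Poly) (i : Fin 3) : Poly := X (i + 1) * q (i + 2) - X (i + 2) * q (i + 1)

theorem radial_eq (q : Fin 3 → Poly) : radial q = X 0 * q 0 + X 1 * q 1 + X 2 * q 2 := by
  simp [radial, Fin.sum_univ_three]

theorem crossX_zero (q : Fin 3 → Poly) : crossX q 0 = X 1 * q 2 - X 2 * q 1 := rfl

theorem crossX_one (q : Fin 3 → Poly) : crossX q 1 = X 2 * q 0 - X 0 * q 2 := rfl

theorem crossX_two (q : Fin 3 → Poly) : crossX q 2 = X 0 * q 1 - X 1 * q 0 := rfl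

theorem pderiv_mem_harmonic {n : ℕ} {f : Poly} (hf : f ∈ harmonic (n + 1)) (i : Fin 3) :
    pderiv i f ∈ harmonic n :=
  mem_harmonic.mpr ⟨hf.1.pderiv, by rw [laplacian_pderiv, (mem_harmonic.mp hf).2, map_zero]⟩

theorem divergence_mem_harmonic {n : ℕ} {q : Fin 3 → Poly} (hq : ∀ i, q i ∈ harmonic (n + 1)) :
    divergence q ∈ harmonic n :=
  Submodule.sum_mem _ fun i _ => pderiv_mem_harmonic (hq i) i

theorem curl_mem_harmonic {n : ℕ} {q : Fin 3 → Poly} (hq : ∀ i, q i ∈ harmonic (n + 1))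
    (i : Fin 3) : curl q i ∈ harmonic n :=
  Submodule.sub_mem _ (pderiv_mem_harmonic (hq _) _) (pderiv_mem_harmonic (hq _) _)

theorem laplacian_radial (q : Fin 3 → Poly) :
    laplacian (radial q) = radial (fun i => laplacian (q i)) + 2 * divergence q := by
  simp only [radial_eq, divergence_eq, map_add, laplacian_X_mul]
  ring

theorem pderiv_radial {n : ℕ} {q : Fin 3 → Poly} (hq : ∀ i, (q i).IsHomogeneous n) (i : Fin 3) :
    pderiv i (radial q) = ((n : Poly) + 1) * q i + crossX (curl q) i := by
  have h := euler (hq i)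
  rw [radial_eq, add_mul, ← h]
  fin_cases i <;>
  simp [crossX_zero, crossX_one, crossX_two, curl_zero, curl_one, curl_two, Derivation.leibniz,
    pderiv_X] <;> ring

/-! ### Gradients of harmonic polynomials -/

theorem gradient_mem_harmonic {n : ℕ} {h : Poly} (hh : h ∈ harmonic (n + 1)) (i : Fin 3) :
    gradient h i ∈ harmonic n := pderiv_mem_harmonic hh i

theorem divergence_gradient (h : Poly) : divergence (gradient h) = laplacian h := by
  rw [divergence_eq, laplacian_apply]
  rfl

theorem curl_gradient (h : Poly) (i : Fin 3) : curl (gradient h) i = 0 :=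
  sub_eq_zero.mpr (pderiv_comm _ _ h)

theorem eq_zero_of_gradient_eq_zero {n : ℕ} {h : Poly} (hh : h.IsHomogeneous (n + 1))
    (h0 : gradient h = 0) : h = 0 := by
  have h1 := euler hh
  simp only [← gradient_apply, h0, Pi.zero_apply, mul_zero, add_zero] at h1
  exact (mul_eq_zero.mp h1.symm).resolve_left (Nat.cast_ne_zero.mpr n.succ_ne_zero)

theorem exists_eq_gradient {n : ℕ} {q : Fin 3 → Poly} (hq : ∀ i, q i ∈ harmonic n)
    (hd : divergence q = 0) (hc : ∀ i, curl q i = 0) :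
    ∃ h ∈ harmonic (n + 1), gradient h = q := by
  have hr : radial q ∈ harmonic (n + 1) := by
    refine mem_harmonic.mpr ⟨?_, ?_⟩
    · refine (homogeneousSubmodule (Fin 3) ℝ (n + 1)).sum_mem fun i _ => ?_
      rw [mem_homogeneousSubmodule, add_comm]
      exact (isHomogeneous_X ℝ i).mul (hq i).1
    · rw [laplacian_radial, hd, radial_eq]
      simp [(mem_harmonic.mp (hq _)).2]
  have hn : (n + 1 : ℝ) ≠ 0 := by positivity
  refine ⟨(n + 1 : ℝ)⁻¹ • radial q, Submodule.smul_mem _ _ hr, funext fun i => ?_⟩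
  rw [map_smul, Pi.smul_apply, inv_smul_eq_iff₀ hn, gradient_apply,
    pderiv_radial (fun i => (hq i).1), smul_eq_C_mul]
  simp [crossX, hc]

/-! ### Tangential fields -/

theorem rotation_mem_harmonic {n : ℕ} {h : Poly} (hh : h ∈ harmonic (n + 1)) (i : Fin 3) :
    rotation h i ∈ harmonic (n + 1) := by
  have hhom (j l : Fin 3) : (X j * pderiv l h).IsHomogeneous (n + 1) := by
    rw [add_comm]
    exact (isHomogeneous_X ℝ j).mul hh.1.pderiv
  refine mem_harmonic.mpr ⟨(hhom _ _).sub (hhom _ _), ?_⟩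
  rw [rotation_apply, map_sub, laplacian_X_mul, laplacian_X_mul,
    laplacian_pderiv, laplacian_pderiv, (mem_harmonic.mp hh).2, pderiv_comm]
  simp

theorem divergence_rotation (h : Poly) : divergence (rotation h) = 0 := by
  rw [divergence_eq, rotation_zero, rotation_one, rotation_two]
  simp [Derivation.leibniz, pderiv_X]
  rw [pderiv_comm 1 0, pderiv_comm 2 0, pderiv_comm 2 1]
  ring

theorem radial_rotation (h : Poly) : radial (rotation h) = 0 := by
  rw [radial_eq, rotation_zero, rotation_one, rotation_two]
  ring

theorem curl_rotation {n : ℕ} {h : Poly} (hh : h ∈ harmonic n) (i : Fin 3) :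
    curl (rotation h) i = -(((n : Poly) + 1) * pderiv i h) := by
  have h1 := euler_pderiv hh.1 i
  have h2 := (mem_harmonic.mp hh).2
  rw [laplacian_apply] at h2
  fin_cases i
  all_goals
    simp [curl_zero, curl_one, curl_two, rotation_zero, rotation_one, rotation_two,
      Derivation.leibniz, pderiv_X, pderiv_comm 1 0, pderiv_comm 2 0, pderiv_comm 2 1] at h1 ⊢
  · linear_combination X 0 * h2 - h1
  · linear_combination X 1 * h2 - h1
  · linear_combination X 2 * h2 - h1

theorem eq_zero_of_rotation_eq_zero {n : ℕ} {h : Poly} (hh : h ∈ harmonic (n + 1))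
    (h0 : rotation h = 0) : h = 0 := by
  refine eq_zero_of_gradient_eq_zero hh.1 (funext fun i => ?_)
  have h1 := curl_rotation hh i
  simp only [h0, curl, Pi.zero_apply, map_zero, sub_self] at h1
  exact (mul_eq_zero.mp (neg_eq_zero.mp h1.symm)).resolve_left (Nat.cast_add_one_ne_zero (n + 1))

theorem exists_eq_rotation {n : ℕ} {q : Fin 3 → Poly} (hq : ∀ i, q i ∈ harmonic (n + 1))
    (hd : divergence q = 0) (hr : radial q = 0) :
    ∃ h ∈ harmonic (n + 1), rotation h = q := by
  have hL (i : Fin 3) := (mem_harmonic.mp (hq i)).2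
  have hdd (i : Fin 3) := congrArg (pderiv i) hd
  simp only [divergence_eq, map_add, map_zero] at hdd
  simp only [laplacian_apply] at hL
  obtain ⟨u, hu, hu'⟩ := exists_eq_gradient (curl_mem_harmonic hq)
    (by
      rw [divergence_eq, curl_zero, curl_one, curl_two]
      simp only [map_sub, pderiv_comm 1 0, pderiv_comm 2 0, pderiv_comm 2 1]
      ring)
    (fun i => by
      have h1 := hL i
      have h2 := hdd i
      fin_cases i
      all_goals
        simp [curl_zero, curl_one, curl_two, pderiv_comm 1 0, pderiv_comm 2 0,
          pderiv_comm 2 1] at h1 h2 ⊢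
        linear_combination h2 - h1)
  have hn : (-(n + 2) : ℝ) ≠ 0 := by linarith [n.cast_nonneg (α := ℝ)]
  refine ⟨(-(n + 2) : ℝ)⁻¹ • u, Submodule.smul_mem _ _ hu, funext fun i => ?_⟩
  have h1 := pderiv_radial (fun i => (hq i).1) i
  have h2 : rotation u i = crossX (curl q) i := by rw [← hu']; rfl
  rw [hr, map_zero] at h1
  rw [map_smul, Pi.smul_apply, inv_smul_eq_iff₀ hn, h2, smul_eq_C_mul]
  simp only [map_neg, map_add, map_natCast, map_ofNat]
  push_cast at h1
  linear_combination -h1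

/-! ### Exterior fields -/

theorem exterior_mem_harmonic {n : ℕ} {h : Poly} (hh : h ∈ harmonic n) (i : Fin 3) :
    exterior n h i ∈ harmonic (n + 1) := by
  refine mem_harmonic.mpr ⟨?_, ?_⟩
  · have h1 : (normSq * pderiv i h).IsHomogeneous (n + 1) := by
      rcases n with _ | n
      · rw [pderiv_eq_zero_of_isHomogeneous_zero hh.1, mul_zero]
        exact isHomogeneous_zero _ _ _
      · rw [show n + 1 + 1 = 2 + n by ring]
        exact isHomogeneous_normSq.mul hh.1.pderiv
    have h2 : (((2 * n + 1 : ℕ) : Poly) * X i * h).IsHomogeneous (n + 1) := by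
      rw [add_comm n, ← map_natCast (C : ℝ →+* Poly)]
      exact ((isHomogeneous_X ℝ i).C_mul _).mul hh.1
    exact h1.sub h2
  · have h1 := euler_pderiv hh.1 i
    have h2 (f : Poly) : laplacian (((2 * n + 1 : ℕ) : Poly) * f) =
        ((2 * n + 1 : ℕ) : Poly) * laplacian f := by
      rw [← nsmul_eq_mul, map_nsmul, nsmul_eq_mul]
    rw [exterior_apply, map_sub, mul_assoc, h2, laplacian_X_mul,
      laplacian_normSq_mul, laplacian_pderiv, (mem_harmonic.mp hh).2, h1]
    push_cast
    simp
    ring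

theorem divergence_exterior {n : ℕ} {h : Poly} (hh : h ∈ harmonic n) :
    divergence (exterior n h) = -(((n : Poly) + 1) * (2 * n + 3) * h) := by
  have h1 := euler hh.1
  have h2 := (mem_harmonic.mp hh).2
  rw [laplacian_apply] at h2
  rw [divergence_eq]
  simp only [exterior_apply, map_sub, mul_assoc, pderiv_natCast_mul]
  simp [Derivation.leibniz, pderiv_normSq]
  linear_combination normSq * h2 + (1 - 2 * (n : Poly)) * h1

theorem radial_exterior {n : ℕ} {h : Poly} (hh : h ∈ harmonic n) :
    radial (exterior n h) = -(((n : Poly) + 1) * normSq * h) := by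
  have h1 := euler hh.1
  simp only [radial_eq, exterior_apply, normSq]
  push_cast
  linear_combination (X 0 ^ 2 + X 1 ^ 2 + X 2 ^ 2) * h1

theorem curl_exterior (n : ℕ) (h : Poly) (i : Fin 3) :
    curl (exterior n h) i = (2 * n + 3) * rotation h i := by
  simp only [curl, rotation_apply, exterior_apply, map_sub, mul_assoc, pderiv_natCast_mul]
  fin_cases i <;> simp [Derivation.leibniz, pderiv_normSq, pderiv_X, pderiv_comm 1 0,
    pderiv_comm 2 0, pderiv_comm 2 1] <;> ring

theorem crossX_exterior (n : ℕ) (h : Poly) (i : Fin 3) :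
    crossX (exterior n h) i = normSq * rotation h i := by
  simp only [crossX, rotation_apply, exterior_apply]
  ring

theorem eq_zero_of_exterior_eq_zero {n : ℕ} {h : Poly} (hh : h ∈ harmonic n)
    (h0 : exterior n h = 0) : h = 0 := by
  have h1 := divergence_exterior hh
  have h2 : ((n : Poly) + 1) * (2 * n + 3) ≠ 0 := by
    have : (((n + 1) * (2 * n + 3) : ℕ) : Poly) ≠ 0 := Nat.cast_ne_zero.mpr (by positivity)
    exact_mod_cast this
  simp only [h0, divergence, Pi.zero_apply, map_zero, Finset.sum_const_zero] at h1
  exact (mul_eq_zero.mp (neg_eq_zero.mp h1.symm)).resolve_left h2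

theorem exists_eq_exterior {n : ℕ} {q : Fin 3 → Poly} (hq : ∀ i, q i ∈ harmonic (n + 1))
    (hd : normSq * divergence q = (2 * n + 3) * radial q)
    (hc : ∀ i, normSq * curl q i = (2 * n + 3) * crossX q i) :
    ∃ h ∈ harmonic n, exterior n h = q := by
  have hn : (-((n + 1) * (2 * n + 3)) : ℝ) ≠ 0 := by
    have : (0 : ℝ) < (n + 1) * (2 * n + 3) := by positivity
    linarith
  refine ⟨(-((n + 1) * (2 * n + 3)) : ℝ)⁻¹ • divergence q,
    Submodule.smul_mem _ _ (divergence_mem_harmonic hq), funext fun i => ?_⟩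
  have h1 := pderiv_radial (fun i => (hq i).1) i
  have h2 : crossX (curl q) i = X i * divergence q - (2 * (n : Poly) + 3) * q i := by
    apply mul_left_cancel₀ normSq_ne_zero
    have hr := radial_eq q
    have c0 := hc 0
    have c1 := hc 1
    have c2 := hc 2
    rw [crossX_zero] at c0
    rw [crossX_one] at c1
    rw [crossX_two] at c2
    rw [mul_sub, mul_left_comm, hd, hr, normSq]
    rw [normSq] at c0 c1 c2
    fin_cases i
    · simp only [Fin.zero_eta, crossX_zero]
      linear_combination X 1 * c2 - X 2 * c1
    · simp only [Fin.mk_one, crossX_one]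
      linear_combination X 2 * c0 - X 0 * c2
    · simp only [Fin.reduceFinMk, crossX_two]
      linear_combination X 0 * c1 - X 1 * c0
  have h3 := congrArg (pderiv i) hd
  rw [show (2 * (n : Poly) + 3) = ((2 * n + 3 : ℕ) : Poly) by push_cast; ring,
    pderiv_natCast_mul, h1, h2, Derivation.leibniz, pderiv_normSq] at h3
  rw [map_smul, Pi.smul_apply, inv_smul_eq_iff₀ hn, exterior_apply, smul_eq_C_mul]
  simp only [map_neg, map_mul, map_add, map_natCast, map_ofNat, map_one, smul_eq_mul] at h3 ⊢
  push_cast at h3 ⊢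
  linear_combination h3

/-! ### Polynomial vector fields as functions -/

theorem hasFDerivAt_eval (f : Poly) (x : V3) :
    HasFDerivAt (fun y : V3 => eval y f)
      (∑ i, eval x (pderiv i f) • ContinuousLinearMap.proj (R := ℝ) (φ := fun _ : Fin 3 => ℝ) i)
      x := by
  induction f using MvPolynomial.induction_on with
  | C a => simpa using hasFDerivAt_const a x
  | add p q hp hq =>
    simp only [map_add, add_smul, Finset.sum_add_distrib]
    exact hp.add hq
  | mul_X p j hp =>
    simp only [map_mul, eval_X]
    convert! hp.mul (ContinuousLinearMap.proj (R := ℝ) (φ := fun _ : Fin 3 => ℝ) j).hasFDerivAt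
      using 1
    ext v
    fin_cases j <;>
      simp [Derivation.leibniz, pderiv_X, Fin.sum_univ_three] <;> ring

theorem pd_eval (i : Fin 3) (f : Poly) (x : V3) :
    pd i (fun y => eval y f) x = eval x (pderiv i f) := by
  rw [pd, (hasFDerivAt_eval f x).fderiv]
  simp [Pi.single_apply]

/-- The vector field on `ℝ³` given by a triple of polynomials. -/
def toField : (Fin 3 → Poly) →ₗ[ℝ] (V3 → V3) where
  toFun q x i := eval x (q i)
  map_add' q r := by ext; simp
  map_smul' c q := by ext; simp

theorem toField_apply (q : Fin 3 → Poly) (x : V3) (i : Fin 3) :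
    toField q x i = eval x (q i) := rfl

theorem toField_injective : Function.Injective toField := fun _ _ h =>
  funext fun i => MvPolynomial.funext fun x => congrFun (congrFun h x) i

theorem div3_toField (q : Fin 3 → Poly) (x : V3) :
    div3 (toField q) x = eval x (divergence q) := by
  simp only [div3, toField_apply, pd_eval, divergence, map_sum]

theorem curl3_toField (q : Fin 3 → Poly) (x : V3) (i : Fin 3) :
    curl3 (toField q) x i = eval x (curl q i) := by
  simp only [curl3, toField_apply, pd_eval, curl, map_sub]

theorem mem_Pk_iff {k : ℕ} {f : V3 → ℝ} :
    f ∈ Pk k ↔ ∃ q ∈ harmonic k, f = fun x => eval x q := by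
  have hlap (q : Poly) (x : V3) :
      ∑ i, pd i (pd i fun y => eval y q) x = eval x (laplacian q) := by
    have h (i : Fin 3) : pd i (fun y => eval y q) = fun y => eval y (pderiv i q) :=
      funext fun y => pd_eval i q y
    simp only [h, pd_eval, laplacian_apply, Fin.sum_univ_three, map_add]
  constructor
  · rintro ⟨⟨q, hq, hf⟩, hL⟩
    obtain rfl : f = fun x => eval x q := funext hf
    refine ⟨q, mem_harmonic.mpr ⟨hq, MvPolynomial.funext fun x => ?_⟩, rfl⟩
    rw [← hlap, hL, map_zero]
  · rintro ⟨q, hq, rfl⟩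
    refine ⟨⟨q, hq.1, fun _ => rfl⟩, fun x => ?_⟩
    rw [hlap, (mem_harmonic.mp hq).2, map_zero]

theorem toField_mem_Pk3 {k : ℕ} {q : Fin 3 → Poly} (hq : ∀ i, q i ∈ harmonic k) :
    toField q ∈ Pk3 k := fun i => mem_Pk_iff.mpr ⟨q i, hq i, rfl⟩

theorem exists_toField_of_mem_Pk3 {k : ℕ} {p : V3 → V3} (hp : p ∈ Pk3 k) :
    ∃ q : Fin 3 → Poly, (∀ i, q i ∈ harmonic k) ∧ toField q = p := by
  have h (i : Fin 3) : ∃ q ∈ harmonic k, (fun x => p x i) = fun x => eval x q :=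
    mem_Pk_iff.mp (hp i)
  choose q hq using h
  refine ⟨q, fun i => (hq i).1, ?_⟩
  ext x i
  rw [toField_apply]
  exact (congrFun (hq i).2 x).symm

theorem forall_eval_eq_zero_iff {f : Poly} : (∀ x, eval x f = 0) ↔ f = 0 :=
  ⟨fun h => MvPolynomial.funext fun x => by rw [h, map_zero], fun h x => by rw [h, map_zero]⟩

theorem forall_div3_eq_zero_iff {q : Fin 3 → Poly} :
    (∀ x, div3 (toField q) x = 0) ↔ divergence q = 0 := by
  simp only [div3_toField, forall_eval_eq_zero_iff]

theorem forall_curl3_eq_zero_iff {q : Fin 3 → Poly} :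
    (∀ x, curl3 (toField q) x = 0) ↔ ∀ i, curl q i = 0 := by
  simp only [funext_iff, curl3_toField, Pi.zero_apply, ← forall_eval_eq_zero_iff]
  exact forall_comm

/-! ### The Kelvin transform -/

theorem norm3_eq (x : V3) : norm3 x = Real.sqrt (eval x normSq) := by
  simp [norm3, dot3, normSq, Fin.sum_univ_three, sq]

theorem eval_normSq_pos {x : V3} (hx : x ≠ 0) : 0 < eval x normSq := by
  obtain ⟨i, hi⟩ := Function.ne_iff.mp hx
  have hi' : 0 < x i ^ 2 := sq_pos_iff.mpr hi
  simp only [normSq, map_add, map_pow, eval_X]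
  fin_cases i <;> simp only [Fin.zero_eta, Fin.mk_one, Fin.reduceFinMk] at hi' <;>
    linarith [sq_nonneg (x 0), sq_nonneg (x 1), sq_nonneg (x 2)]

theorem pd_kelvin (k : ℕ) (q : Fin 3 → Poly) (i j : Fin 3) {x : V3} (hx : x ≠ 0) :
    pd i (fun y => kelvin k (toField q) y j) x = (norm3 x ^ (2 * k + 3))⁻¹ *
      eval x (normSq * pderiv i (q j) - ((2 * k + 1 : ℕ) : Poly) * (X i * q j)) := by
  have hpos := eval_normSq_pos hx
  have hN : norm3 x ≠ 0 := by rw [norm3_eq]; exact (Real.sqrt_pos.mpr hpos).ne'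
  have hN2 : norm3 x ^ 2 = eval x normSq := by rw [norm3_eq, Real.sq_sqrt hpos.le]
  have hn := (hasFDerivAt_eval normSq x).sqrt hpos.ne'
  simp only [← norm3_eq] at hn
  have h := ((hasDerivAt_inv (pow_ne_zero (2 * k + 1) hN)).comp_hasFDerivAt x
    (hn.pow (2 * k + 1))).mul (hasFDerivAt_eval (q j) x)
  have hpd (l : Fin 3) (f : Poly) : (∑ m, eval x (pderiv m f) •
      ContinuousLinearMap.proj (R := ℝ) (φ := fun _ : Fin 3 => ℝ) m) (Pi.single l 1) =
      eval x (pderiv l f) := by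
    simp [Pi.single_apply]
  have h' : pd i (fun y => kelvin k (toField q) y j) x = _ :=
    congrArg (fun L : V3 →L[ℝ] ℝ => L (Pi.single i 1)) h.fderiv
  rw [h']
  simp only [add_apply, smul_apply, hpd, smul_eq_mul, nsmul_eq_mul]
  simp only [pderiv_normSq, Function.comp_apply, map_sub, map_mul, eval_X, map_natCast, ← hN2,
    Nat.add_sub_cancel, map_ofNat]
  field_simp
  ring

theorem div3_kelvin (k : ℕ) (q : Fin 3 → Poly) {x : V3} (hx : x ≠ 0) :
    div3 (kelvin k (toField q)) x = (norm3 x ^ (2 * k + 3))⁻¹ *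
      eval x (normSq * divergence q - ((2 * k + 1 : ℕ) : Poly) * radial q) := by
  simp only [div3, pd_kelvin k q _ _ hx, ← Finset.mul_sum, ← map_sum, divergence, radial,
    Finset.sum_sub_distrib]

theorem curl3_kelvin (k : ℕ) (q : Fin 3 → Poly) (i : Fin 3) {x : V3} (hx : x ≠ 0) :
    curl3 (kelvin k (toField q)) x i = (norm3 x ^ (2 * k + 3))⁻¹ *
      eval x (normSq * curl q i - ((2 * k + 1 : ℕ) : Poly) * crossX q i) := by
  simp only [curl3, pd_kelvin k q _ _ hx, ← mul_sub, ← map_sub, curl, crossX]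
  congr 2
  ring

theorem forall_norm3_mul_eval_eq_zero_iff {n : ℕ} {f : Poly} (hf : eval 0 f = 0) :
    (∀ x : V3, x ≠ 0 → (norm3 x ^ n)⁻¹ * eval x f = 0) ↔ f = 0 := by
  rw [← forall_eval_eq_zero_iff]
  refine ⟨fun h x => ?_, fun h x _ => by rw [h, mul_zero]⟩
  rcases eq_or_ne x 0 with rfl | hx
  · exact hf
  · refine (mul_eq_zero.mp (h x hx)).resolve_left (inv_ne_zero (pow_ne_zero n ?_))
    rw [norm3_eq]
    exact (Real.sqrt_pos.mpr (eval_normSq_pos hx)).ne'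

theorem forall_div3_kelvin_eq_zero_iff {k : ℕ} {q : Fin 3 → Poly} :
    (∀ x : V3, x ≠ 0 → div3 (kelvin k (toField q)) x = 0) ↔
      normSq * divergence q = ((2 * k + 1 : ℕ) : Poly) * radial q := by
  rw [← sub_eq_zero, ← forall_norm3_mul_eval_eq_zero_iff (n := 2 * k + 3) (by simp [normSq, radial])]
  exact forall₂_congr fun x hx => by rw [div3_kelvin k q hx]

theorem forall_curl3_kelvin_eq_zero_iff {k : ℕ} {q : Fin 3 → Poly} :
    (∀ x : V3, x ≠ 0 → curl3 (kelvin k (toField q)) x = 0) ↔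
      ∀ i, normSq * curl q i = ((2 * k + 1 : ℕ) : Poly) * crossX q i := by
  have h (i : Fin 3) : normSq * curl q i = ((2 * k + 1 : ℕ) : Poly) * crossX q i ↔
      ∀ x : V3, x ≠ 0 → curl3 (kelvin k (toField q)) x i = 0 := by
    rw [← sub_eq_zero,
      ← forall_norm3_mul_eval_eq_zero_iff (n := 2 * k + 3) (by simp [normSq, crossX])]
    exact forall₂_congr fun x hx => by rw [curl3_kelvin k q i hx]
  simp only [h, funext_iff, Pi.zero_apply]
  exact ⟨fun h i x hx => h x hx i, fun h x hx i => h i x hx⟩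

/-! ### Parametrizations of the three spaces -/

theorem exists_basis_of_parametrization {m n : ℕ} (hmn : 2 * m + 1 = n)
    (Φ : Poly →ₗ[ℝ] (Fin 3 → Poly)) (S : Set (V3 → V3))
    (hinj : ∀ h ∈ harmonic m, Φ h = 0 → h = 0)
    (hS : ∀ p, p ∈ S ↔ ∃ h ∈ harmonic m, toField (Φ h) = p) :
    ∃ b : Fin n → (V3 → V3), LinearIndependent ℝ b ∧ (∀ j, b j ∈ S) ∧
      ∀ p ∈ S, p ∈ Submodule.span ℝ (Set.range b) := by
  let B : Module.Basis (Fin n) ℝ (harmonic m) :=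
    Module.finBasisOfFinrankEq ℝ (harmonic m) ((finrank_harmonic m).trans hmn)
  let F : harmonic m →ₗ[ℝ] (V3 → V3) := toField ∘ₗ Φ ∘ₗ (harmonic m).subtype
  have hF : LinearMap.ker F = ⊥ := by
    refine (Submodule.eq_bot_iff _).mpr fun h hh => Subtype.ext (hinj h h.2 ?_)
    exact toField_injective ((LinearMap.mem_ker.mp hh).trans (map_zero toField).symm)
  refine ⟨F ∘ B, B.linearIndependent.map' F hF, fun j => (hS _).mpr ⟨B j, (B j).2, rfl⟩,
    fun p hp => ?_⟩
  obtain ⟨h, hh, rfl⟩ := (hS p).mp hp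
  rw [Set.range_comp, Submodule.span_image, B.span_eq]
  exact ⟨⟨h, hh⟩, trivial, rfl⟩

theorem mem_Wkm_iff {k : ℕ} {p : V3 → V3} :
    p ∈ Wkm k ↔ ∃ h ∈ harmonic (k + 1), toField (gradient h) = p := by
  constructor
  · rintro ⟨hp, hd, hc⟩
    obtain ⟨q, hq, rfl⟩ := exists_toField_of_mem_Pk3 hp
    obtain ⟨h, hh, rfl⟩ :=
      exists_eq_gradient hq (forall_div3_eq_zero_iff.mp hd) (forall_curl3_eq_zero_iff.mp hc)
    exact ⟨h, hh, rfl⟩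
  · rintro ⟨h, hh, rfl⟩
    exact ⟨toField_mem_Pk3 (gradient_mem_harmonic hh),
      forall_div3_eq_zero_iff.mpr ((divergence_gradient h).trans (mem_harmonic.mp hh).2),
      forall_curl3_eq_zero_iff.mpr (curl_gradient h)⟩

theorem mem_Wko_iff {n : ℕ} {p : V3 → V3} :
    p ∈ Wko (n + 1) ↔ ∃ h ∈ harmonic (n + 1), toField (rotation h) = p := by
  constructor
  · rintro ⟨hp, hd, hk⟩
    obtain ⟨q, hq, rfl⟩ := exists_toField_of_mem_Pk3 hp
    rw [forall_div3_eq_zero_iff] at hd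
    rw [forall_div3_kelvin_eq_zero_iff, hd, mul_zero] at hk
    obtain ⟨h, hh, rfl⟩ := exists_eq_rotation hq hd
      ((mul_eq_zero.mp hk.symm).resolve_left (Nat.cast_ne_zero.mpr (Nat.succ_ne_zero _)))
    exact ⟨h, hh, rfl⟩
  · rintro ⟨h, hh, rfl⟩
    refine ⟨toField_mem_Pk3 (rotation_mem_harmonic hh),
      forall_div3_eq_zero_iff.mpr (divergence_rotation h),
      forall_div3_kelvin_eq_zero_iff.mpr ?_⟩
    rw [divergence_rotation, radial_rotation, mul_zero, mul_zero]

theorem mem_Wkp_iff {n : ℕ} {p : V3 → V3} :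
    p ∈ Wkp (n + 1) ↔ ∃ h ∈ harmonic n, toField (exterior n h) = p := by
  have hn : ((2 * (n + 1) + 1 : ℕ) : Poly) = 2 * n + 3 := by push_cast; ring
  constructor
  · rintro ⟨hp, hd, hc⟩
    obtain ⟨q, hq, rfl⟩ := exists_toField_of_mem_Pk3 hp
    rw [forall_div3_kelvin_eq_zero_iff, hn] at hd
    rw [forall_curl3_kelvin_eq_zero_iff, hn] at hc
    obtain ⟨h, hh, rfl⟩ := exists_eq_exterior hq hd hc
    exact ⟨h, hh, rfl⟩
  · rintro ⟨h, hh, rfl⟩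
    refine ⟨toField_mem_Pk3 (exterior_mem_harmonic hh), forall_div3_kelvin_eq_zero_iff.mpr ?_,
      forall_curl3_kelvin_eq_zero_iff.mpr fun i => ?_⟩
    · rw [divergence_exterior hh, radial_exterior hh, hn]
      ring
    · rw [curl_exterior, crossX_exterior, hn]
      ring

end HarmonicField

/-- For every `k ≥ 1`, `dim W_k^o = 2k+1`, `dim W_k^- = 2k+3` and
`dim W_k^+ = 2k-1`: each space admits a linearly independent family of that cardinality
which spans it. -/
theorem dim_Wko_Wkm_Wkp (k : ℕ) (hk : 1 ≤ k) :
    (∃ b : Fin (2 * k + 1) → (V3 → V3), LinearIndependent ℝ b ∧ (∀ j, b j ∈ Wko k) ∧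
      ∀ p ∈ Wko k, p ∈ Submodule.span ℝ (Set.range b)) ∧
    (∃ b : Fin (2 * k + 3) → (V3 → V3), LinearIndependent ℝ b ∧ (∀ j, b j ∈ Wkm k) ∧
      ∀ p ∈ Wkm k, p ∈ Submodule.span ℝ (Set.range b)) ∧
    (∃ b : Fin (2 * k - 1) → (V3 → V3), LinearIndependent ℝ b ∧ (∀ j, b j ∈ Wkp k) ∧
      ∀ p ∈ Wkp k, p ∈ Submodule.span ℝ (Set.range b)) := by
  obtain ⟨n, rfl⟩ := Nat.exists_eq_add_of_le' hk
  refine ⟨?_, ?_, ?_⟩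
  · exact HarmonicField.exists_basis_of_parametrization rfl HarmonicField.rotation _
      (fun _ => HarmonicField.eq_zero_of_rotation_eq_zero) fun _ => HarmonicField.mem_Wko_iff
  · exact HarmonicField.exists_basis_of_parametrization (by ring) HarmonicField.gradient _
      (fun _ hh => HarmonicField.eq_zero_of_gradient_eq_zero hh.1) fun _ =>
        HarmonicField.mem_Wkm_iff
  · exact HarmonicField.exists_basis_of_parametrization (by omega) (HarmonicField.exterior n) _
      (fun _ => HarmonicField.eq_zero_of_exterior_eq_zero) fun _ => HarmonicField.mem_Wkp_iff
end
end

section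
/- Let k ≥ 0 and let p : ℝ³ → ℝ³ be a vector field whose components are homogeneous polynomials of degree k. If x·p(x) = 0 for all x ∈ ℝ³ and the Jacobian of p is symmetric (∂p_i/∂x_j = ∂p_j/∂x_i for all i, j, i.e. ∇×p = 0 on ℝ³), then p is identically zero. -/
noncomputable section

open scoped BigOperators

/-- Polynomial functions have the formal partial derivatives as Fréchet derivative. -/
lemma hasFDerivAt_mvPolynomial_eval {ι : Type*} [Fintype ι] (q : MvPolynomial ι ℝ) (x : ι → ℝ) :
    HasFDerivAt (fun y => MvPolynomial.eval y q)
      (∑ i, MvPolynomial.eval x (MvPolynomial.pderiv i q) •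
        (ContinuousLinearMap.proj i : (ι → ℝ) →L[ℝ] ℝ)) x := by
  classical
  induction q using MvPolynomial.induction_on with
  | C a => simpa using hasFDerivAt_const a x
  | add p q hp hq =>
    simp only [map_add, add_smul, Finset.sum_add_distrib]
    exact hp.add hq
  | mul_X p n hp =>
    have hX : HasFDerivAt (fun y : ι → ℝ => y n)
        (ContinuousLinearMap.proj n : (ι → ℝ) →L[ℝ] ℝ) x := hasFDerivAt_apply n x
    simp only [map_mul, MvPolynomial.eval_X]
    refine (hp.mul hX).congr_fderiv ?_
    ext v
    have hite (i : ι) : MvPolynomial.eval x (if n = i then p else 0) =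
        if n = i then MvPolynomial.eval x p else 0 := by split_ifs <;> simp
    simp [MvPolynomial.pderiv_X, Pi.single_apply, hite, add_mul, Finset.sum_add_distrib,
      Finset.mul_sum, mul_assoc]

lemma pd_mvPolynomial_eval (q : MvPolynomial (Fin 3) ℝ) (j : Fin 3) (x : V3) :
    pd j (fun y => MvPolynomial.eval y q) x = MvPolynomial.eval x (MvPolynomial.pderiv j q) := by
  simp [pd, (hasFDerivAt_mvPolynomial_eval q x).fderiv, Pi.single_apply]

/-- If `p` has homogeneous polynomial components of degree `k`, `x·p(x) = 0`
on `ℝ³`, and the Jacobian of `p` is symmetric (`∂p_i/∂x_j = ∂p_j/∂x_i` for all `i, j`, i.e.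
`∇×p = 0`), then `p` is identically zero. -/
theorem tangential_curl_free_zero (k : ℕ) (p : V3 → V3)
    (hp : ∀ i, IsHomogPoly k (fun x => p x i))
    (htan : ∀ x, dot3 x (p x) = 0)
    (hsym : ∀ (x : V3) (i j : Fin 3),
      pd j (fun y => p y i) x = pd i (fun y => p y j) x) :
    ∀ x, p x = 0 := by
  choose q hq hpq using hp
  have hsymm (i j : Fin 3) :
      MvPolynomial.pderiv j (q i) = MvPolynomial.pderiv i (q j) := by
    refine MvPolynomial.funext fun x => ?_
    simpa only [hpq, pd_mvPolynomial_eval] using hsym x i j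
  have htangent : ∑ i, MvPolynomial.X i * q i = 0 := by
    refine MvPolynomial.funext fun x => ?_
    simpa [dot3, hpq] using htan x
  intro x
  funext j
  have hdiff : q j + ∑ i, MvPolynomial.X i * MvPolynomial.pderiv i (q j) = 0 := by
    have h := congrArg (MvPolynomial.pderiv j) htangent
    simpa [MvPolynomial.pderiv_X, Pi.single_apply, Finset.sum_add_distrib, hsymm _ j,
      add_comm] using h
  rw [(hq j).sum_X_mul_pderiv] at hdiff
  have h := congrArg (MvPolynomial.eval x) hdiff
  simp only [nsmul_eq_mul, map_add, map_mul, map_natCast, map_zero] at h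
  have hk : (1 + k : ℝ) * MvPolynomial.eval x (q j) = 0 := by linear_combination h
  rw [show p x j = _ from hpq j x]
  exact (mul_eq_zero.mp hk).resolve_left (by positivity)
end
end

section
/- Let k ≥ 0 and let p : ℝ³ → ℝ³ be a vector field whose components are homogeneous polynomials of degree k and which satisfies x·p(x) = 0 for all x ∈ ℝ³. Let p*(x) := |x|^{−(2k+1)} p(x) be its Kelvin transform on ℝ³∖{0}. Then for every x with |x| = 1, x × (∇×p*)(x) − x × (∇×p)(x) = (2k+1) p(x). -/
noncomputable section

open scoped BigOperators

theorem MvPolynomial.differentiable_eval {ι : Type*} [Fintype ι] (q : MvPolynomial ι ℝ) :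
    Differentiable ℝ (fun x : ι → ℝ => MvPolynomial.eval x q) := by
  induction q using MvPolynomial.induction_on with
  | C a => simp
  | add q r hq hr => simpa using hq.fun_add hr
  | mul_X q i hq => simpa using hq.fun_mul (differentiable_apply i)

theorem IsHomogPoly.differentiable {k : ℕ} {f : V3 → ℝ} (hf : IsHomogPoly k f) :
    Differentiable ℝ f := by
  obtain ⟨q, -, hq⟩ := hf
  rw [funext hq]
  exact q.differentiable_eval

theorem hasFDerivAt_dot3_self (x : V3) :
    HasFDerivAt (fun y : V3 => dot3 y y)
      (∑ i, (2 * x i) • ContinuousLinearMap.proj (R := ℝ) (φ := fun _ : Fin 3 => ℝ) i) x := by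
  refine HasFDerivAt.fun_sum fun i _ => ?_
  have h := hasFDerivAt_apply (𝕜 := ℝ) i x
  exact (h.fun_mul h).congr_fderiv (by rw [← add_smul, two_mul])

/-- On the unit sphere, the gradient of `|x|⁻ⁿ` is `-n x`. -/
theorem hasFDerivAt_inv_norm3_pow (n : ℕ) {x : V3} (hx : norm3 x = 1) :
    HasFDerivAt (fun y : V3 => (norm3 y ^ n)⁻¹)
      (-(n : ℝ) • ∑ i, x i • ContinuousLinearMap.proj (R := ℝ) (φ := fun _ : Fin 3 => ℝ) i) x := by
  have hd : dot3 x x = 1 := Real.sqrt_eq_one.mp hx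
  have hs := (hasFDerivAt_dot3_self x).sqrt (by simp [hd])
  have hinv : HasDerivAt (fun t : ℝ => (t ^ n)⁻¹) (-(n : ℝ)) √(dot3 x x) := by
    have h := (hasDerivAt_pow n √(dot3 x x)).fun_inv (by simp [hd])
    simpa [hd] using h
  refine (hinv.comp_hasFDerivAt x hs).congr_fderiv ?_
  simp [hd, mul_smul, ← Finset.smul_sum]
  exact (neg_smul _ _).symm

theorem pd_inv_norm3_pow_mul (n : ℕ) {f : V3 → ℝ} {x : V3} (hx : norm3 x = 1)
    (hf : DifferentiableAt ℝ f x) (i : Fin 3) :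
    pd i (fun y => (norm3 y ^ n)⁻¹ * f y) x = pd i f x - n * x i * f x := by
  rw [pd, ((hasFDerivAt_inv_norm3_pow n hx).fun_mul hf.hasFDerivAt).fderiv, pd]
  simp [hx, Pi.single_apply]
  ring

/-- On the unit sphere, `∇ × p* = ∇ × p - (2k+1) x × p`. -/
theorem curl3_kelvin_of_norm3_eq_one (k : ℕ) {p : V3 → V3} {x : V3} (hx : norm3 x = 1)
    (hp : ∀ i, DifferentiableAt ℝ (fun y => p y i) x) :
    curl3 (kelvin k p) x = curl3 p x - (2 * (k : ℝ) + 1) • cross3 x (p x) := by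
  ext i
  simp only [curl3, kelvin, Pi.smul_apply, smul_eq_mul, Pi.sub_apply, cross3,
    pd_inv_norm3_pow_mul _ hx (hp _)]
  push_cast
  ring

theorem cross3_sub (x y z : V3) : cross3 x (y - z) = cross3 x y - cross3 x z := by
  ext i
  simp only [cross3, Pi.sub_apply]
  ring

theorem cross3_smul (c : ℝ) (x y : V3) : cross3 x (c • y) = c • cross3 x y := by
  ext i
  simp only [cross3, Pi.smul_apply, smul_eq_mul]
  ring

theorem cross3_cross3_self (x y : V3) :
    cross3 x (cross3 x y) = dot3 x y • x - dot3 x x • y := by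
  ext i
  fin_cases i <;> simp [cross3, dot3, Fin.sum_univ_three] <;> ring

/-- If `p` has homogeneous polynomial components of degree `k` and
`x·p(x) = 0` on `ℝ³`, then for every `x` with `|x| = 1`,
`x × (∇×p*)(x) − x × (∇×p)(x) = (2k+1) p(x)`. -/
theorem kelvin_curl_jump_on_sphere (k : ℕ) (p : V3 → V3)
    (hp : ∀ i, IsHomogPoly k (fun x => p x i))
    (htan : ∀ x, dot3 x (p x) = 0) :
    ∀ x : V3, norm3 x = 1 →
      cross3 x (curl3 (kelvin k p) x) - cross3 x (curl3 p x) = (2 * (k : ℝ) + 1) • p x := by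
  intro x hx
  have hd : dot3 x x = 1 := Real.sqrt_eq_one.mp hx
  rw [curl3_kelvin_of_norm3_eq_one k hx fun i => (hp i).differentiable x, cross3_sub, cross3_smul,
    cross3_cross3_self, htan x, hd]
  simp
end
end
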